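/- arXiv:0801.3792 — 3 statements merged into one kernel-verified Lean document; each statement's English description precedes it below -/
import Mathlib

section
/- Let G be a finite abelian group, S a sequence over G of length |S| ≥ |G| + 1, and k ∈ ℕ with k ≤ |supp(S)|. If h(S) ≤ |G| − k + 2 and 0 ∉ Σ_{|G|}(S), then |Σ_{|G|}(S)| ≥ |S| − |G| + k − 1. -/
/-- The set of sums of `k`-term subsequences of `S`. -/
def subsums {G : Type*} [AddCommGroup G] (S : Multiset G) (k : ℕ) : Set G :=
  {x | ∃ T ≤ S, Multiset.card T = k ∧ T.sum = x}

universe u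
section DGM
open Finset
open scoped Pointwise
variable {G : Type u} [AddCommGroup G]

/-- stabilizer of a finite set -/
def dstab (C : Finset G) : AddSubgroup G where
  carrier := {g | ∀ c, g + c ∈ C ↔ c ∈ C}
  zero_mem' := by intro c; simp
  add_mem' := by
    intro a b ha hb c
    rw [add_assoc, ha, hb]
  neg_mem' := by
    intro a ha c
    rw [← ha (-a + c)]; simp

theorem mem_dstab {C : Finset G} {g : G} : g ∈ dstab C ↔ ∀ c, g + c ∈ C ↔ c ∈ C := Iff.rfl

theorem mem_dstab_of {C : Finset G} {g : G} (h : ∀ c ∈ C, g + c ∈ C) : g ∈ dstab C := by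
  have hs : C.map (addLeftEmbedding g) = C := by
    apply Finset.eq_of_subset_of_card_le
    · intro x hx
      rw [Finset.mem_map] at hx
      obtain ⟨c, hc, rfl⟩ := hx
      exact h c hc
    · simp
  intro c
  constructor
  · intro hc
    rw [← hs, Finset.mem_map] at hc
    obtain ⟨d, hd, he⟩ := hc
    have : d = c := by simpa using he
    exact this ▸ hd
  · exact h c

variable [Fintype G]

/-- finset of elements of a subgroup -/
noncomputable def LF (H : AddSubgroup G) : Finset G := by
  classical exact univ.filter (· ∈ H)

theorem mem_LF {H : AddSubgroup G} {g : G} : g ∈ LF H ↔ g ∈ H := by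
  classical simp [LF]

theorem LF_pos (H : AddSubgroup G) : 0 < (LF H).card :=
  Finset.card_pos.2 ⟨0, mem_LF.2 H.zero_mem⟩

theorem card_ge_of_per {M : AddSubgroup G} {P : Finset G} {a : G}
    (h : ∀ z ∈ M, a + z ∈ P) : (LF M).card ≤ P.card := by
  apply Finset.card_le_card_of_injOn (fun z => a + z)
  · intro z hz; exact h z (mem_LF.1 hz)
  · intro x _ y _ hxy; simpa using hxy

theorem prod_le {H₁ H₂ : AddSubgroup G} {Q R Z : Finset G} {c : G}
    (hQ : ∀ q ∈ Q, q ∈ H₁) (hR : ∀ q ∈ R, q ∈ H₂)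
    (h : ∀ q ∈ Q, ∀ r ∈ R, c + q + r ∈ Z) :
    Q.card * R.card ≤ (LF (H₁ ⊓ H₂)).card * Z.card := by
  classical
  rw [← Finset.card_product]
  apply Finset.card_le_mul_card_image_of_maps_to (f := fun p : G × G => c + p.1 + p.2)
  · intro p hp
    rw [Finset.mem_product] at hp
    exact h _ hp.1 _ hp.2
  · intro b _
    by_cases hne : ((Q ×ˢ R).filter (fun p : G × G => c + p.1 + p.2 = b)).Nonempty
    · obtain ⟨p0, hp0⟩ := hne
      rw [Finset.mem_filter, Finset.mem_product] at hp0
      apply Finset.card_le_card_of_injOn (fun p => p.1 - p0.1)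
      · intro p hp
        simp only [Finset.coe_filter, Finset.mem_product, Set.mem_ofPred_eq] at hp
        apply mem_LF.2
        refine ⟨H₁.sub_mem (hQ _ hp.1.1) (hQ _ hp0.1.1), ?_⟩
        have : p.1 - p0.1 = p0.2 - p.2 := by
          have := hp.2.trans hp0.2.symm
          rw [add_assoc, add_assoc] at this
          have := add_left_cancel this
          rw [sub_eq_sub_iff_add_eq_add, this, add_comm]
        show p.1 - p0.1 ∈ H₂
        rw [this]
        exact H₂.sub_mem (hR _ hp0.1.2) (hR _ hp.1.2)
      · intro p hp p' hp' hh
        simp only [Finset.coe_filter, Finset.mem_product, Set.mem_ofPred_eq] at hp hp'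
        have h1 : p.1 = p'.1 := by simpa using hh
        have h2 : p.2 = p'.2 := by
          have := hp.2.trans hp'.2.symm
          rw [h1] at this
          exact add_left_cancel this
        exact Prod.ext h1 h2
    · rw [Finset.not_nonempty_iff_eq_empty] at hne
      rw [hne]; simp

theorem union_half {C₁ C₂ : Finset G} {H₁ H₂ : AddSubgroup G} [DecidableEq G]
    (h1 : H₁ ≤ dstab C₁) (h2 : H₂ ≤ dstab C₂) {c : G} (hc2 : c ∈ C₂) (hc1 : c ∉ C₁) :
    (LF H₁).card ≤ (C₂ \ C₁).card + (LF (H₁ ⊓ H₂)).card ∨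
    (LF H₂).card ≤ (C₁ \ C₂).card + (LF (H₁ ⊓ H₂)).card ∨
    (LF H₂).card ≤ (C₂ \ C₁).card := by
  have k1 : ∀ z ∈ H₁, ∀ x, x + z ∈ C₁ ↔ x ∈ C₁ := fun z hz x => by
    rw [add_comm]; exact h1 hz x
  have k2 : ∀ z ∈ H₂, ∀ x, x + z ∈ C₂ ↔ x ∈ C₂ := fun z hz x => by
    rw [add_comm]; exact h2 hz x
  have ea : ((LF H₁).filter (fun h => c + h ∈ C₂)).card
      + ((LF H₁).filter (fun h => ¬ c + h ∈ C₂)).card = (LF H₁).card :=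
    Finset.card_filter_add_card_filter_not _
  have eb : ((LF H₂).filter (fun h => c + h ∈ C₁)).card
      + ((LF H₂).filter (fun h => ¬ c + h ∈ C₁)).card = (LF H₂).card :=
    Finset.card_filter_add_card_filter_not _
  have p2 : ((LF H₁).filter (fun h => c + h ∈ C₂)).card *
      ((LF H₂).filter (fun h => ¬ c + h ∈ C₁)).card
      ≤ (LF (H₁ ⊓ H₂)).card * (C₂ \ C₁).card := by
    apply prod_le (c := c)
    · intro q hq; exact mem_LF.1 (Finset.mem_filter.1 hq).1
    · intro q hq; exact mem_LF.1 (Finset.mem_filter.1 hq).1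
    · intro q hq r hr
      rw [Finset.mem_filter, mem_LF] at hq hr
      rw [Finset.mem_sdiff, k2 r hr.1, add_right_comm, k1 q hq.1]
      exact ⟨hq.2, hr.2⟩
  have p1 : ((LF H₁).filter (fun h => ¬ c + h ∈ C₂)).card *
      ((LF H₂).filter (fun h => c + h ∈ C₁)).card
      ≤ (LF (H₁ ⊓ H₂)).card * (C₁ \ C₂).card := by
    apply prod_le (c := c)
    · intro q hq; exact mem_LF.1 (Finset.mem_filter.1 hq).1
    · intro q hq; exact mem_LF.1 (Finset.mem_filter.1 hq).1
    · intro q hq r hr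
      rw [Finset.mem_filter, mem_LF] at hq hr
      rw [Finset.mem_sdiff, k2 r hr.1, add_right_comm, k1 q hq.1]
      exact ⟨hr.2, hq.2⟩
  have g1 : (LF (H₁ ⊓ H₂)).card ≤ ((LF H₁).filter (fun h => c + h ∈ C₂)).card := by
    apply card_ge_of_per (a := 0)
    intro z hz
    rw [Finset.mem_filter, mem_LF, zero_add, k2 z hz.2]
    exact ⟨hz.1, hc2⟩
  have g2 : (LF (H₁ ⊓ H₂)).card ≤ ((LF H₂).filter (fun h => ¬ c + h ∈ C₁)).card := by
    apply card_ge_of_per (a := 0)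
    intro z hz
    rw [Finset.mem_filter, mem_LF, zero_add, k1 z hz.1]
    exact ⟨hz.2, hc1⟩
  have g3 : ((LF H₂).filter (fun h => c + h ∈ C₁)).card = 0 ∨
      (LF (H₁ ⊓ H₂)).card ≤ ((LF H₂).filter (fun h => c + h ∈ C₁)).card := by
    rcases Finset.eq_empty_or_nonempty ((LF H₂).filter (fun h => c + h ∈ C₁)) with h | ⟨a, ha⟩
    · left; rw [h]; rfl
    · right
      rw [Finset.mem_filter, mem_LF] at ha
      apply card_ge_of_per (a := a)
      intro z hz
      rw [Finset.mem_filter, mem_LF, ← add_assoc, k1 z hz.1]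
      exact ⟨H₂.add_mem ha.1 hz.2, ha.2⟩
  have g4 : ((LF H₁).filter (fun h => ¬ c + h ∈ C₂)).card = 0 ∨
      (LF (H₁ ⊓ H₂)).card ≤ ((LF H₁).filter (fun h => ¬ c + h ∈ C₂)).card := by
    rcases Finset.eq_empty_or_nonempty ((LF H₁).filter (fun h => ¬ c + h ∈ C₂)) with h | ⟨a, ha⟩
    · left; rw [h]; rfl
    · right
      rw [Finset.mem_filter, mem_LF] at ha
      apply card_ge_of_per (a := a)
      intro z hz
      rw [Finset.mem_filter, mem_LF, ← add_assoc, k2 z hz.2]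
      exact ⟨H₁.add_mem ha.1 hz.1, ha.2⟩
  have hm := LF_pos (H₁ ⊓ H₂)
  revert ea eb p1 p2 g1 g2 g3 g4 hm
  generalize ((LF H₁).filter (fun h => c + h ∈ C₂)).card = u2
  generalize ((LF H₁).filter (fun h => ¬ c + h ∈ C₂)).card = v2
  generalize ((LF H₂).filter (fun h => c + h ∈ C₁)).card = u1
  generalize ((LF H₂).filter (fun h => ¬ c + h ∈ C₁)).card = v1
  generalize (LF (H₁ ⊓ H₂)).card = μ
  generalize (LF H₁).card = a
  generalize (LF H₂).card = b
  generalize (C₂ \ C₁).card = d2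
  generalize (C₁ \ C₂).card = d1
  intro ea eb p2 p1 g1 g2 g3 g4 hm
  subst ea eb
  rcases g3 with rfl | g3
  · right; right
    simp only [zero_add]
    refine le_of_mul_le_mul_left (a := μ) ?_ hm
    exact (Nat.mul_le_mul_right _ g1).trans p2
  rcases g4 with rfl | g4
  · left
    have : u2 ≤ d2 := by
      refine le_of_mul_le_mul_left (a := μ) ?_ hm
      calc μ * u2 = u2 * μ := mul_comm _ _
        _ ≤ u2 * v1 := Nat.mul_le_mul_left _ g2
        _ ≤ _ := p2
    omega
  by_contra hcon
  push Not at hcon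
  obtain ⟨w1, w2, -⟩ := hcon
  obtain ⟨x2, rfl⟩ := Nat.exists_eq_add_of_le g1
  obtain ⟨y1, rfl⟩ := Nat.exists_eq_add_of_le g2
  obtain ⟨x1, rfl⟩ := Nat.exists_eq_add_of_le g3
  obtain ⟨y2, rfl⟩ := Nat.exists_eq_add_of_le g4
  have e2 : d2 + 1 ≤ μ + x2 + y2 := by omega
  have e1 : d1 + 1 ≤ μ + x1 + y1 := by omega
  have q1 : μ * (μ + x2 + y2) ≤ (μ + x2) * (μ + y2) := by nlinarith [Nat.zero_le (x2 * y2)]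
  have q2 : μ * (μ + x1 + y1) ≤ (μ + x1) * (μ + y1) := by nlinarith [Nat.zero_le (x1 * y1)]
  have q3 := Nat.mul_le_mul q1 q2
  have q4 := Nat.mul_le_mul p2 p1
  have q5 : (μ * (d2 + 1)) * (μ * (d1 + 1)) ≤ (μ * d2) * (μ * d1) := by
    calc _ ≤ (μ * (μ + x2 + y2)) * (μ * (μ + x1 + y1)) :=
          Nat.mul_le_mul (Nat.mul_le_mul_left _ e2) (Nat.mul_le_mul_left _ e1)
      _ ≤ _ := q3
      _ = _ := by ring
      _ ≤ _ := q4
  have q6 : 0 < μ * μ := Nat.mul_pos hm hm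
  nlinarith [Nat.zero_le (μ * μ * d1), Nat.zero_le (μ * μ * d2)]

theorem LF_mono {H K : AddSubgroup G} (h : H ≤ K) : (LF H).card ≤ (LF K).card :=
  Finset.card_le_card fun _ hx => mem_LF.2 (h (mem_LF.1 hx))

theorem union_lemma [DecidableEq G] {C₁ C₂ : Finset G} {r : ℕ} (h12 : ¬ C₁ ⊆ C₂) (h21 : ¬ C₂ ⊆ C₁)
    (h1 : r ≤ C₁.card + (LF (dstab C₁)).card) (h2 : r ≤ C₂.card + (LF (dstab C₂)).card) :
    r ≤ (C₁ ∪ C₂).card + (LF (dstab (C₁ ∪ C₂))).card := by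
  obtain ⟨a, ha1, ha2⟩ := Finset.not_subset.1 h12
  obtain ⟨b, hb2, hb1⟩ := Finset.not_subset.1 h21
  have A := union_half (C₁ := C₁) (C₂ := C₂) le_rfl le_rfl hb2 hb1
  have B := union_half (C₁ := C₂) (C₂ := C₁) le_rfl le_rfl ha1 ha2
  rw [inf_comm] at B
  have hM : (LF (dstab C₁ ⊓ dstab C₂)).card ≤ (LF (dstab (C₁ ∪ C₂))).card := by
    apply LF_mono
    intro g hg c
    rw [Finset.mem_union, Finset.mem_union, hg.1 c, hg.2 c]
  have c1 : (C₁ ∪ C₂).card = C₁.card + (C₂ \ C₁).card := by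
    rw [← Finset.union_sdiff_self_eq_union, Finset.card_union_of_disjoint Finset.disjoint_sdiff]
  have c2 : (C₁ ∪ C₂).card = C₂.card + (C₁ \ C₂).card := by
    rw [Finset.union_comm, ← Finset.union_sdiff_self_eq_union,
      Finset.card_union_of_disjoint Finset.disjoint_sdiff]
  omega

theorem kneser_aux [DecidableEq G] (N : ℕ) : ∀ (A B : Finset G), B.card ≤ N → 0 ∈ A → 0 ∈ B →
    ∃ C ⊆ A + B, 0 ∈ C ∧ A.card + B.card ≤ C.card + (LF (dstab C)).card := by
  induction N with
  | zero =>
    intro A B hB _ h0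
    have := Finset.card_pos.2 ⟨0, h0⟩
    omega
  | succ N ih =>
    intro A B hB hA0 hB0
    by_cases hex : ∃ e ∈ A, ∃ b ∈ B, e + b ∉ A
    · obtain ⟨e, he, b, hb, heb⟩ := hex
      have hcl : (B.filter (fun x => e + x ∈ A)).card < B.card := by
        apply Finset.card_lt_card
        rw [Finset.filter_ssubset]
        exact ⟨b, hb, heb⟩
      obtain ⟨C, hC, h0C, hcard⟩ := ih (A ∪ B.map (addLeftEmbedding e))
        (B.filter (fun x => e + x ∈ A)) (by omega) (Finset.mem_union_left _ hA0)
        (by simp [hB0, he])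
      refine ⟨C, hC.trans ?_, h0C, ?_⟩
      · intro x hx
        obtain ⟨y, hy, z, hz, rfl⟩ := Finset.mem_add.1 hx
        rw [Finset.mem_filter] at hz
        rcases Finset.mem_union.1 hy with hy | hy
        · exact Finset.add_mem_add hy hz.1
        · obtain ⟨w, hw, rfl⟩ := Finset.mem_map.1 hy
          have : (addLeftEmbedding e) w + z = (e + z) + w := by
            simp only [addLeftEmbedding_apply]; abel
          rw [this]
          exact Finset.add_mem_add hz.2 hw
      · refine le_trans (le_of_eq ?_) hcard
        have e1 := Finset.card_union_add_card_inter A (B.map (addLeftEmbedding e))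
        have e2 : (A ∩ B.map (addLeftEmbedding e)) =
            (B.filter (fun x => e + x ∈ A)).map (addLeftEmbedding e) := by
          ext x
          simp only [Finset.mem_inter, Finset.mem_map, Finset.mem_filter, addLeftEmbedding_apply]
          constructor
          · rintro ⟨h, b, hb, rfl⟩; exact ⟨b, ⟨hb, h⟩, rfl⟩
          · rintro ⟨b, ⟨hb, h⟩, rfl⟩; exact ⟨h, b, hb, rfl⟩
        rw [e2, Finset.card_map, Finset.card_map] at e1
        omega
    · push Not at hex
      refine ⟨A, ?_, hA0, ?_⟩
      · intro x hx
        have := Finset.add_mem_add hx hB0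
        rwa [add_zero] at this
      · apply Nat.add_le_add_left
        apply Finset.card_le_card
        intro b hb
        apply mem_LF.2
        apply mem_dstab_of
        intro c hc
        rw [add_comm]
        exact hex c hc b hb

theorem kneser_pt [DecidableEq G] (A B : Finset G) {a b : G} (ha : a ∈ A) (hb : b ∈ B) :
    ∃ C ⊆ A + B, a + b ∈ C ∧ A.card + B.card ≤ C.card + (LF (dstab C)).card := by
  obtain ⟨C, hC, h0, hcard⟩ := kneser_aux B.card (A.map (addLeftEmbedding (-a)))
    (B.map (addLeftEmbedding (-b))) (by simp)
    (Finset.mem_map.2 ⟨a, ha, by simp⟩) (Finset.mem_map.2 ⟨b, hb, by simp⟩)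
  have hmem : ∀ x, x ∈ C.map (addLeftEmbedding (a + b)) ↔ x - (a + b) ∈ C := by
    intro x
    rw [Finset.mem_map]
    constructor
    · rintro ⟨y, hy, rfl⟩; simpa using hy
    · intro h; exact ⟨_, h, by simp⟩
  refine ⟨C.map (addLeftEmbedding (a + b)), ?_, ?_, ?_⟩
  · intro x hx
    obtain ⟨y, hy, rfl⟩ := Finset.mem_map.1 hx
    obtain ⟨p, hp, q, hq, rfl⟩ := Finset.mem_add.1 (hC hy)
    obtain ⟨p, hp', rfl⟩ := Finset.mem_map.1 hp
    obtain ⟨q, hq', rfl⟩ := Finset.mem_map.1 hq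
    have : (addLeftEmbedding (a + b)) ((addLeftEmbedding (-a)) p + (addLeftEmbedding (-b)) q)
        = p + q := by
      simp only [addLeftEmbedding_apply]; abel
    rw [this]
    exact Finset.add_mem_add hp' hq'
  · rw [hmem]; simpa using h0
  · rw [Finset.card_map, Finset.card_map] at hcard
    rw [Finset.card_map]
    refine hcard.trans (Nat.add_le_add_left (LF_mono ?_) _)
    intro g hg c
    rw [hmem, hmem, add_sub_assoc]
    exact hg _

theorem kneser [DecidableEq G] (A B : Finset G) (hA : A.Nonempty) (hB : B.Nonempty) :
    A.card + B.card ≤ (A + B).card + (LF (dstab (A + B))).card := by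
  obtain ⟨a, ha⟩ := hA
  obtain ⟨b, hb⟩ := hB
  have hne : ((A + B).powerset.filter
      (fun C => A.card + B.card ≤ C.card + (LF (dstab C)).card)).Nonempty := by
    obtain ⟨C, hC, -, h⟩ := kneser_pt A B ha hb
    exact ⟨C, Finset.mem_filter.2 ⟨Finset.mem_powerset.2 hC, h⟩⟩
  obtain ⟨C, hC, hmax⟩ := Finset.exists_max_image _ Finset.card hne
  rw [Finset.mem_filter, Finset.mem_powerset] at hC
  by_cases hall : A + B ⊆ C
  · have := Finset.Subset.antisymm hall hC.1
    rw [this]; exact hC.2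
  · exfalso
    obtain ⟨c, hc, hcC⟩ := Finset.not_subset.1 hall
    obtain ⟨a, ha, b, hb, rfl⟩ := Finset.mem_add.1 hc
    obtain ⟨D, hD, habD, hDc⟩ := kneser_pt A B ha hb
    have h21 : ¬ D ⊆ C := fun h => hcC (h habD)
    by_cases h12 : C ⊆ D
    · have := hmax D (Finset.mem_filter.2 ⟨Finset.mem_powerset.2 hD, hDc⟩)
      exact h21 (Finset.eq_of_subset_of_card_le h12 this).ge
    · have hu := union_lemma h12 h21 hC.2 hDc
      have := hmax (C ∪ D)
        (Finset.mem_filter.2 ⟨Finset.mem_powerset.2 (Finset.union_subset hC.1 hD), hu⟩)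
      have h3 := Finset.eq_of_subset_of_card_le Finset.subset_union_left this
      exact h21 (h3 ▸ Finset.subset_union_right)

end DGM

section DGM2
open Finset
open scoped Pointwise
open scoped Classical
variable {G : Type u} [AddCommGroup G]

/-- n-term subsequence sums as a finset -/
noncomputable def sig (S : Multiset G) (n : ℕ) : Finset G :=
  ((S.powersetCard n).map Multiset.sum).toFinset

theorem mem_sig {S : Multiset G} {n : ℕ} {x : G} :
    x ∈ sig S n ↔ ∃ T ≤ S, T.card = n ∧ T.sum = x := by
  simp only [sig, Multiset.mem_toFinset, Multiset.mem_map, Multiset.mem_powersetCard, and_assoc]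

theorem sig_nonempty {S : Multiset G} {n : ℕ} (h : n ≤ S.card) : (sig S n).Nonempty := by
  have : 0 < (S.powersetCard n).card := by
    rw [Multiset.card_powersetCard]; exact Nat.choose_pos h
  obtain ⟨T, hT⟩ := Multiset.card_pos_iff_exists_mem.1 this
  rw [Multiset.mem_powersetCard] at hT
  exact ⟨T.sum, mem_sig.2 ⟨T, hT.1, hT.2, rfl⟩⟩

theorem sig_mono {S S' : Multiset G} (h : S ≤ S') (n : ℕ) : sig S n ⊆ sig S' n := by
  intro x hx
  obtain ⟨T, hT, h1, h2⟩ := mem_sig.1 hx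
  exact mem_sig.2 ⟨T, hT.trans h, h1, h2⟩

theorem sig_add {S S' : Multiset G} (n n' : ℕ) : sig S n + sig S' n' ⊆ sig (S + S') (n + n') := by
  intro x hx
  obtain ⟨y, hy, z, hz, rfl⟩ := Finset.mem_add.1 hx
  obtain ⟨T, hT, h1, h2⟩ := mem_sig.1 hy
  obtain ⟨T', hT', h1', h2'⟩ := mem_sig.1 hz
  exact mem_sig.2 ⟨T + T', add_le_add hT hT', by simp [h1, h1'], by simp [h2, h2']⟩

/-- number of terms in a coset -/
noncomputable def nn (H : AddSubgroup G) (S : Multiset G) (g : G) : ℕ :=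
  (S.filter (fun s : G => (s : G ⧸ H) = (g : G ⧸ H))).card

theorem nn_mono (H : AddSubgroup G) {S S' : Multiset G} (h : S ≤ S') (g : G) :
    nn H S g ≤ nn H S' g :=
  Multiset.card_le_card (Multiset.filter_le_filter _ h)

theorem nn_add (H : AddSubgroup G) (S S' : Multiset G) (g : G) :
    nn H (S + S') g = nn H S g + nn H S' g := by
  simp [nn]

theorem nn_le_card (H : AddSubgroup G) (S : Multiset G) (g : G) : nn H S g ≤ S.card :=
  Multiset.card_le_card (Multiset.filter_le _ _)

theorem mk_eq_of_le {L K : AddSubgroup G} (h : L ≤ K) {a b : G} (hab : (a : G ⧸ L) = b) :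
    (a : G ⧸ K) = b := by
  rw [QuotientAddGroup.eq] at hab ⊢
  exact h hab

theorem nn_le_of_le {L K : AddSubgroup G} (h : L ≤ K) (S : Multiset G) (g : G) :
    nn L S g ≤ nn K S g := by
  apply Multiset.card_le_card
  apply Multiset.monotone_filter_right
  intro a ha
  exact mk_eq_of_le h ha

theorem nn_congr {H : AddSubgroup G} (S : Multiset G) {g g' : G} (h : (g : G ⧸ H) = g') :
    nn H S g = nn H S g' := by
  simp only [nn, h]

theorem nn_bot (S : Multiset G) (g : G) : nn (⊥ : AddSubgroup G) S g = S.count g := by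
  rw [nn, Multiset.count_eq_card_filter_eq]
  congr 1
  apply Multiset.filter_congr
  intro x _
  rw [QuotientAddGroup.eq, AddSubgroup.mem_bot, neg_add_eq_zero, eq_comm]

theorem count_le_nn (H : AddSubgroup G) (S : Multiset G) (g : G) : S.count g ≤ nn H S g := by
  rw [← nn_bot]; exact nn_le_of_le bot_le S g

variable [Fintype G]

theorem card_coset (H : AddSubgroup G) (a : G) :
    (univ.filter (fun g : G => (a : G ⧸ H) = g)).card = (LF H).card := by
  symm
  apply Finset.card_bij (fun z _ => a + z)
  · intro z hz
    rw [Finset.mem_filter, QuotientAddGroup.eq]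
    simpa using mem_LF.1 hz
  · intro x _ y _ h; simpa using h
  · intro b hb
    rw [Finset.mem_filter, QuotientAddGroup.eq] at hb
    exact ⟨-a + b, mem_LF.2 hb.2, by simp⟩

theorem sum_nn (H : AddSubgroup G) (S : Multiset G) :
    ∑ g : G, nn H S g = S.card * (LF H).card := by
  induction S using Multiset.induction_on with
  | empty => simp [nn]
  | cons a S ih =>
    have : ∀ g, nn H (a ::ₘ S) g = (if (a : G ⧸ H) = g then 1 else 0) + nn H S g := by
      intro g
      rw [← Multiset.singleton_add, nn_add]
      congr 1
      by_cases h : (a : G ⧸ H) = g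
      · simp [nn, h, Multiset.filter_singleton]
      · simp [nn, h, Multiset.filter_singleton]
    simp only [this, Finset.sum_add_distrib, ih, Multiset.card_cons]
    rw [← Finset.card_filter, card_coset]
    ring

theorem mem_add_LF {A : Finset G} {L : AddSubgroup G} {g : G} :
    g ∈ A + LF L ↔ ∃ a ∈ A, (a : G ⧸ L) = g := by
  rw [Finset.mem_add]
  constructor
  · rintro ⟨a, ha, z, hz, rfl⟩
    refine ⟨a, ha, ?_⟩
    rw [QuotientAddGroup.eq]; simpa using mem_LF.1 hz
  · rintro ⟨a, ha, h⟩
    rw [QuotientAddGroup.eq] at h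
    exact ⟨a, ha, -a + g, mem_LF.2 h, by simp⟩

theorem LF_add_LF (L : AddSubgroup G) : LF L + LF L = LF L := by
  ext g
  rw [Finset.mem_add]
  constructor
  · rintro ⟨a, ha, b, hb, rfl⟩
    exact mem_LF.2 (L.add_mem (mem_LF.1 ha) (mem_LF.1 hb))
  · intro h
    exact ⟨g, h, 0, mem_LF.2 L.zero_mem, by simp⟩

theorem dstab_le_add (A B : Finset G) : dstab A ≤ dstab (A + B) := by
  intro g hg
  apply mem_dstab_of
  intro c hc
  obtain ⟨a, ha, b, hb, rfl⟩ := Finset.mem_add.1 hc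
  rw [← add_assoc]
  exact Finset.add_mem_add ((hg a).2 ha) hb

theorem add_LF_eq {A : Finset G} {L : AddSubgroup G} (h : L ≤ dstab A) : A + LF L = A := by
  ext g
  rw [Finset.mem_add]
  constructor
  · rintro ⟨a, ha, z, hz, rfl⟩
    rw [add_comm]
    exact (h (mem_LF.1 hz) a).2 ha
  · intro hg
    exact ⟨g, hg, 0, mem_LF.2 L.zero_mem, by simp⟩

theorem le_dstab_add_LF (A : Finset G) (L : AddSubgroup G) : L ≤ dstab (A + LF L) := by
  intro z hz
  apply mem_dstab_of
  intro c hc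
  obtain ⟨a, ha, b, hb, rfl⟩ := Finset.mem_add.1 hc
  rw [add_left_comm]
  exact Finset.add_mem_add ha (mem_LF.2 (L.add_mem hz (mem_LF.1 hb)))

theorem kneser_rel {A B : Finset G} {L : AddSubgroup G} (hA : A.Nonempty) (hB : B.Nonempty)
    (h : dstab (A + B + LF L) ≤ L) :
    (A + LF L).card + (B + LF L).card ≤ (A + B + LF L).card + (LF L).card := by
  have e : (A + LF L) + (B + LF L) = A + B + LF L := by
    rw [add_add_add_comm, LF_add_LF]
  have hL : (LF L).Nonempty := ⟨0, mem_LF.2 L.zero_mem⟩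
  have := kneser (A + LF L) (B + LF L) (hA.add hL) (hB.add hL)
  rw [e] at this
  exact this.trans (Nat.add_le_add_left (LF_mono h) _)

/-- relative DeVos-Goddyn-Mohar bound for a sequence -/
def RAP (S : Multiset G) : Prop :=
  ∀ (n : ℕ) (H : AddSubgroup G), 1 ≤ n → n ≤ S.card → dstab (sig S n + LF H) ≤ H →
    (LF H).card + ∑ g : G, min n (nn H S g) ≤ (sig S n + LF H).card + n * (LF H).card

theorem family_bound {ι : Type*} (I : Finset ι) (S : ι → Multiset G) (t : ι → ℕ)
    (hR : ∀ i ∈ I, RAP (S i)) (h1 : ∀ i ∈ I, 1 ≤ t i) (h2 : ∀ i ∈ I, t i ≤ (S i).card) :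
    (∑ i ∈ I, sig (S i) (t i)).Nonempty ∧ 
    ∀ L : AddSubgroup G, dstab ((∑ i ∈ I, sig (S i) (t i)) + LF L) ≤ L →
    (LF L).card + ∑ i ∈ I, ∑ g : G, min (t i) (nn L (S i) g) ≤
      ((∑ i ∈ I, sig (S i) (t i)) + LF L).card + (∑ i ∈ I, t i) * (LF L).card := by
  induction I using Finset.induction_on with
  | empty => simp
  | insert j I hj ih =>
    obtain ⟨ihne, ih⟩ := ih (fun i hi => hR i (Finset.mem_insert_of_mem hi))
      (fun i hi => h1 i (Finset.mem_insert_of_mem hi))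
      (fun i hi => h2 i (Finset.mem_insert_of_mem hi))
    have hjm := Finset.mem_insert_self j I
    have hjne := sig_nonempty (h2 j hjm)
    simp only [Finset.sum_insert hj]
    refine ⟨hjne.add ihne, ?_⟩
    intro L hL
    have e1 : sig (S j) (t j) + (∑ i ∈ I, sig (S i) (t i)) + LF L
        = (sig (S j) (t j) + LF L) + ∑ i ∈ I, sig (S i) (t i) := by
      rw [add_right_comm]
    have e2 : sig (S j) (t j) + (∑ i ∈ I, sig (S i) (t i)) + LF L
        = ((∑ i ∈ I, sig (S i) (t i)) + LF L) + sig (S j) (t j) := by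
      rw [add_right_comm, add_right_comm, add_comm (sig (S j) (t j)), add_right_comm]
    have a1 := hR j hjm (t j) L (h1 j hjm) (h2 j hjm)
      ((dstab_le_add _ _).trans (by rw [← e1]; exact hL))
    have a2 := ih L ((dstab_le_add _ _).trans (by rw [← e2]; exact hL))
    have a3 := kneser_rel hjne ihne hL
    rw [add_mul]
    omega

theorem sum_quot (H : AddSubgroup G) [Fintype (G ⧸ H)] (φ : G ⧸ H → ℕ) :
    ∑ g : G, φ (g : G ⧸ H) = (LF H).card * ∑ q : G ⧸ H, φ q := by
  rw [← Finset.sum_fiberwise univ (fun g : G => (g : G ⧸ H)), Finset.mul_sum]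
  apply Finset.sum_congr rfl
  intro q _
  obtain ⟨a, rfl⟩ := QuotientAddGroup.mk_surjective q
  rw [← card_coset H a]
  have : (univ.filter (fun g : G => (g : G ⧸ H) = a)) = univ.filter (fun g : G => (a : G ⧸ H) = g) := by
    apply Finset.filter_congr; intro x _; exact eq_comm
  rw [this, ← smul_eq_mul, ← Finset.sum_const]
  apply Finset.sum_congr rfl
  intro x hx
  rw [(Finset.mem_filter.1 hx).2]

theorem sig_map (H : AddSubgroup G) (S : Multiset G) (n : ℕ) :
    sig (S.map (fun g : G => (g : G ⧸ H))) n = (sig S n).image (fun g : G => (g : G ⧸ H)) := by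
  have hsum : ∀ T : Multiset G, (T.map (fun g : G => (g : G ⧸ H))).sum = ((T.sum : G) : G ⧸ H) := by
    intro T
    exact (map_multiset_sum (QuotientAddGroup.mk' H) T).symm
  ext x
  simp only [sig, Multiset.powersetCard_map, Multiset.map_map, Multiset.mem_toFinset,
    Multiset.mem_map, Finset.mem_image, Function.comp, hsum]
  constructor
  · rintro ⟨T, hT, rfl⟩; exact ⟨_, ⟨T, hT, rfl⟩, rfl⟩
  · rintro ⟨_, ⟨T, hT, rfl⟩, rfl⟩; exact ⟨T, hT, rfl⟩

theorem RAP_of_quot (S : Multiset G)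
    (h : ∀ (H : AddSubgroup G) (_ : Fintype (G ⧸ H)) (n : ℕ), 1 ≤ n → n ≤ S.card →
      dstab (sig (S.map (fun g : G => (g : G ⧸ H))) n) = ⊥ →
      1 + ∑ q, min n ((S.map (fun g : G => (g : G ⧸ H))).count q) ≤
        (sig (S.map (fun g : G => (g : G ⧸ H))) n).card + n) : RAP S := by
  intro n H h1 h2 hst
  have : Fintype (G ⧸ H) := Fintype.ofFinite _
  have hA := h H inferInstance n h1 h2 ?_
  · have e1 : ∑ g : G, min n (nn H S g) =
        (LF H).card * ∑ q, min n ((S.map (fun g : G => (g : G ⧸ H))).count q) := by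
      rw [← sum_quot]
      apply Finset.sum_congr rfl
      intro g _
      rw [Multiset.count_map, nn]
      congr 2
      apply Multiset.filter_congr
      intro x _
      exact eq_comm
    have e2 : (sig S n + LF H).card =
        (LF H).card * (sig (S.map (fun g : G => (g : G ⧸ H))) n).card := by
      have a1 : sig S n + LF H = univ.filter (fun g : G => (g : G ⧸ H) ∈
          sig (S.map (fun g : G => (g : G ⧸ H))) n) := by
        ext g
        rw [mem_add_LF, Finset.mem_filter, sig_map, Finset.mem_image]
        simp
      rw [a1, Finset.card_filter, sum_quot H (fun q => if q ∈
          sig (S.map (fun g : G => (g : G ⧸ H))) n then 1 else 0), ← Finset.card_filter]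
      simp
    rw [e1, e2]
    nlinarith
  · rw [eq_bot_iff]
    intro q hq
    obtain ⟨a, rfl⟩ := QuotientAddGroup.mk_surjective q
    rw [AddSubgroup.mem_bot, QuotientAddGroup.eq_zero_iff]
    apply hst
    apply mem_dstab_of
    intro c hc
    rw [mem_add_LF] at hc ⊢
    obtain ⟨b, hb, hbc⟩ := hc
    have := (hq (b : G ⧸ H)).2 (by rw [sig_map]; exact Finset.mem_image_of_mem _ hb)
    rw [sig_map, Finset.mem_image] at this
    obtain ⟨d, hd, hde⟩ := this
    refine ⟨d, hd, ?_⟩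
    rw [hde, QuotientAddGroup.mk_add, hbc]
end DGM2

section DGM3
open Finset
open scoped Pointwise
open scoped Classical
variable {G : Type u} [AddCommGroup G]

theorem sum_sig_subset {ι : Type*} (I : Finset ι) (S : ι → Multiset G) (t : ι → ℕ) :
    ∑ i ∈ I, sig (S i) (t i) ⊆ sig (∑ i ∈ I, S i) (∑ i ∈ I, t i) := by
  induction I using Finset.induction_on with
  | empty =>
    intro x hx
    simp only [Finset.sum_empty, Finset.mem_zero] at hx
    exact mem_sig.2 ⟨0, by simp, by simp, by simp [hx]⟩
  | insert j I hj ih =>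
    simp only [Finset.sum_insert hj]
    exact (Finset.add_subset_add_left ih).trans (sig_add _ _)

theorem mk_sig {K : AddSubgroup G} {S : Multiset G} {i : G ⧸ K} (h : ∀ s ∈ S, (s : G ⧸ K) = i)
    {n : ℕ} {x : G} (hx : x ∈ sig S n) : (x : G ⧸ K) = n • i := by
  obtain ⟨T, hT, hn, rfl⟩ := mem_sig.1 hx
  have : ((T.sum : G) : G ⧸ K) = (T.map (fun g : G => (g : G ⧸ K))).sum :=
    map_multiset_sum (QuotientAddGroup.mk' K) T
  rw [this, ← hn]
  have h2 : T.map (fun g : G => (g : G ⧸ K)) = Multiset.replicate T.card i := by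
    rw [Multiset.eq_replicate]
    refine ⟨by simp, ?_⟩
    intro b hb
    obtain ⟨a, ha, rfl⟩ := Multiset.mem_map.1 hb
    exact h a (Multiset.mem_of_le hT ha)
  rw [h2, Multiset.sum_replicate]

theorem mk_sum_sig {K : AddSubgroup G} (S : Multiset G) (t : G ⧸ K → ℕ) (I : Finset (G ⧸ K)) :
    ∀ x ∈ ∑ i ∈ I, sig (S.filter (fun s : G => (s : G ⧸ K) = i)) (t i),
    (x : G ⧸ K) = ∑ i ∈ I, t i • i := by
  induction I using Finset.induction_on with
  | empty =>
    intro x hx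
    simp only [Finset.sum_empty, Finset.mem_zero] at hx
    simp [hx]
  | insert j I hj ih =>
    intro x hx
    simp only [Finset.sum_insert hj] at hx ⊢
    obtain ⟨y, hy, z, hz, rfl⟩ := Finset.mem_add.1 hx
    rw [QuotientAddGroup.mk_add, ih z hz, mk_sig (i := j) _ hy]
    intro s hs
    exact (Multiset.mem_filter.1 hs).2

theorem sum_filter_le {K : AddSubgroup G} (S : Multiset G) (I : Finset (G ⧸ K)) :
    ∑ i ∈ I, S.filter (fun s : G => (s : G ⧸ K) = i) ≤ S := by
  rw [Multiset.le_iff_count]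
  intro a
  rw [Multiset.count_sum']
  simp only [Multiset.count_filter]
  rw [Finset.sum_ite_eq]
  split_ifs <;> simp

/-- truncated coset multiplicity -/
noncomputable def mK (n : ℕ) (S : Multiset G) (K : AddSubgroup G) (g : G) : ℕ :=
  if ∃ h : G, (h : G ⧸ K) = g ∧ n ≤ S.count h then n else min (n - 1) (nn K S g)

theorem mK_le_nn (n : ℕ) (S : Multiset G) (K : AddSubgroup G) (g : G) : mK n S K g ≤ nn K S g := by
  unfold mK
  split_ifs with h
  · obtain ⟨h, hg, hn⟩ := h
    rw [← nn_congr S hg]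
    exact hn.trans (count_le_nn K S h)
  · exact min_le_right _ _

theorem mK_mono (n : ℕ) (S : Multiset G) {L K : AddSubgroup G} (hLK : L ≤ K) (g : G) :
    mK n S L g ≤ mK n S K g := by
  unfold mK
  split_ifs with h1 h2 h2
  · exact le_rfl
  · obtain ⟨h, hg, hn⟩ := h1
    exact absurd ⟨h, mk_eq_of_le hLK hg, hn⟩ h2
  · exact (min_le_left _ _).trans (Nat.sub_le _ _)
  · exact min_le_min le_rfl (nn_le_of_le hLK S g)

theorem le_mK (n : ℕ) (S : Multiset G) (K : AddSubgroup G) (g : G) :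
    min (n - 1) (nn K S g) ≤ mK n S K g := by
  unfold mK
  split_ifs with h
  · exact (min_le_left _ _).trans (Nat.sub_le _ _)
  · exact le_rfl

variable [Fintype G]

/-- convergent pairs -/
def Conv (S : Multiset G) (n : ℕ) (C : Finset G) (K : AddSubgroup G) : Prop :=
  C ⊆ sig S n ∧ C.Nonempty ∧ K ≤ dstab C ∧
    (LF K).card + ∑ g : G, mK n S K g ≤ C.card + n * (LF K).card

theorem mem_of_mk_eq {C : Finset G} {K : AddSubgroup G} (hK : K ≤ dstab C) {c x : G} (hc : c ∈ C)
    (h : (c : G ⧸ K) = x) : x ∈ C := by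
  rw [QuotientAddGroup.eq] at h
  have := (hK h c).2 hc
  rwa [neg_add_eq_sub, sub_add_cancel] at this

theorem conv_step {S : Multiset G} (hR : ∀ S' : Multiset G, S'.card < S.card → RAP S')
    {n : ℕ} (hn : 1 ≤ n) {C : Finset G} {K : AddSubgroup G} (hC : Conv S n C K) {x : G}
    (hx : x ∈ sig S n) (hxC : x ∉ C) : ∃ C' L, Conv S n C' L ∧ C.card < C'.card := by
  obtain ⟨hCs, hCne, hK, hcard⟩ := hC
  obtain ⟨T, hT, hTn, hTx⟩ := mem_sig.1 hx
  set t : G ⧸ K → ℕ := fun i => (T.map (fun g : G => (g : G ⧸ K))).count i with ht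
  set I : Finset (G ⧸ K) := (T.map (fun g : G => (g : G ⧸ K))).toFinset with hI
  set Si : G ⧸ K → Multiset G := fun i => S.filter (fun s : G => (s : G ⧸ K) = i) with hSi
  have htn : ∀ g : G, t (g : G ⧸ K) = nn K T g := by
    intro g
    simp only [ht]
    rw [Multiset.count_map, nn]
    congr 1
    apply Multiset.filter_congr
    intro x _; exact eq_comm
  have hsumt : ∑ i ∈ I, t i = n := by
    simp only [ht, hI]
    rw [Multiset.toFinset_sum_count_eq, Multiset.card_map, hTn]
  have h1 : ∀ i ∈ I, 1 ≤ t i := by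
    intro i hi
    exact Multiset.one_le_count_iff_mem.2 (Multiset.mem_toFinset.1 hi)
  have h2 : ∀ i ∈ I, t i ≤ (Si i).card := by
    intro i _
    obtain ⟨g, rfl⟩ := QuotientAddGroup.mk_surjective i
    rw [htn]
    exact nn_mono K hT g
  have hmkx : (x : G ⧸ K) = ∑ i ∈ I, t i • i := by
    have e : ((T.sum : G) : G ⧸ K) = (T.map (fun g : G => (g : G ⧸ K))).sum :=
      map_multiset_sum (QuotientAddGroup.mk' K) T
    rw [← hTx, e, Finset.sum_multiset_count]
  have hRi : ∀ i ∈ I, RAP (Si i) := by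
    intro i _
    apply hR
    by_contra hcon
    have hle : Si i ≤ S := Multiset.filter_le _ _
    have heq : Si i = S := Multiset.eq_of_le_of_card_le hle (not_lt.1 hcon)
    have hall : ∀ s ∈ S, (s : G ⧸ K) = i := Multiset.filter_eq_self.1 heq
    obtain ⟨c, hc⟩ := hCne
    exact hxC (mem_of_mk_eq hK hc ((mk_sig hall (hCs hc)).trans (mk_sig hall hx).symm))
  obtain ⟨hDne, hD⟩ := family_bound I Si t hRi h1 h2
  have hmk := mk_sum_sig S t I
  have hDsub : ∑ i ∈ I, sig (Si i) (t i) ⊆ sig S n := by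
    refine (sum_sig_subset I Si t).trans ?_
    rw [hsumt]
    exact sig_mono (sum_filter_le S I) n
  change ∀ x ∈ ∑ i ∈ I, sig (Si i) (t i), _ at hmk
  revert hDne hD hmk hDsub
  generalize ∑ i ∈ I, sig (Si i) (t i) = D
  intro hDne hD hDsub hmk
  have hDC : Disjoint C D := by
    rw [Finset.disjoint_left]
    intro d hdC hdD
    exact hxC (mem_of_mk_eq hK hdC ((hmk d hdD).trans hmkx.symm))
  have hLK : dstab D ≤ K := by
    intro z hz
    obtain ⟨d, hd⟩ := hDne
    have e := (hmk _ ((hz d).2 hd)).trans (hmk d hd).symm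
    rw [QuotientAddGroup.mk_add, add_eq_right] at e
    exact (QuotientAddGroup.eq_zero_iff z).1 e
  refine ⟨C ∪ D, dstab D, ⟨Finset.union_subset hCs hDsub, hCne.mono Finset.subset_union_left, ?_, ?_⟩, ?_⟩
  · intro z hz c
    rw [Finset.mem_union, Finset.mem_union, hz c, hK (hLK hz) c]
  · rw [Finset.card_union_of_disjoint hDC]
    have hb := hD (dstab D) (by rw [add_LF_eq le_rfl])
    rw [add_LF_eq le_rfl, hsumt] at hb
    have hg : ∑ g : G, min (nn K T g) (nn (dstab D) S g) ≤
        ∑ i ∈ I, ∑ g : G, min (t i) (nn (dstab D) (Si i) g) := by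
      rw [Finset.sum_comm]
      apply Finset.sum_le_sum
      intro g _
      by_cases hgI : (g : G ⧸ K) ∈ I
      · have e : nn (dstab D) S g = nn (dstab D) (Si g) g := by
          simp only [nn, hSi]
          rw [Multiset.filter_filter]
          congr 1
          apply Multiset.filter_congr
          intro a _
          constructor
          · intro h; exact ⟨h, mk_eq_of_le hLK h⟩
          · intro h; exact h.1
        rw [e, ← htn]
        exact Finset.single_le_sum
          (f := fun i : G ⧸ K => min (t i) (nn (dstab D) (Si i) g)) (fun _ _ => Nat.zero_le _) hgI
      · have : nn K T g = 0 := by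
          rw [← htn]
          exact Multiset.count_eq_zero.2 (fun h => hgI (Multiset.mem_toFinset.2 h))
        rw [this]; simp
    have hpt : ∀ g : G, mK n S (dstab D) g + nn K T g ≤
        mK n S K g + min (nn K T g) (nn (dstab D) S g) + (if nn K T g = n then 1 else 0) := by
      intro g
      have a1 := mK_le_nn n S (dstab D) g
      have a2 := mK_mono n S hLK g
      have a3 := le_mK n S K g
      have a4 := nn_mono K hT g
      have a5 := nn_le_card K T g
      rw [hTn] at a5
      split_ifs <;> omega
    have hex : ∑ g : G, (if nn K T g = n then 1 else 0) ≤ (LF K).card := by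
      rw [← Finset.card_filter]
      have : 0 < T.card := by omega
      obtain ⟨a, ha⟩ := Multiset.card_pos_iff_exists_mem.1 this
      rw [← card_coset K a]
      apply Finset.card_le_card
      intro g hg
      rw [Finset.mem_filter] at hg ⊢
      refine ⟨Finset.mem_univ _, ?_⟩
      have e : T.filter (fun s : G => (s : G ⧸ K) = g) = T :=
        Multiset.eq_of_le_of_card_le (Multiset.filter_le _ _) (by rw [hTn]; exact hg.2.ge)
      exact Multiset.filter_eq_self.1 e a ha
    have htot := Finset.sum_le_sum (fun g (_ : g ∈ (univ : Finset G)) => hpt g)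
    simp only [Finset.sum_add_distrib] at htot
    rw [sum_nn, hTn] at htot
    omega
  · rw [Finset.card_union_of_disjoint hDC]
    have := Finset.card_pos.2 hDne
    omega

theorem conv_init {S : Multiset G} (hR : ∀ S' : Multiset G, S'.card < S.card → RAP S')
    {n : ℕ} (hn : 2 ≤ n) (hnS : n ≤ S.card) : ∃ C K, Conv S n C K := by
  obtain ⟨A, hA⟩ : ∃ A : Finset G, A.Nonempty ∧ A.val ≤ S ∧ n - 1 ≤ (S - A.val).card ∧
      (∀ h, n ≤ S.count h → h ∈ A) ∧
      ((∀ a ∈ A, n ≤ S.count a) ∨ A.card = 1 ∧ ∀ h, ¬ n ≤ S.count h) := by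
    by_cases hh : ∃ h, n ≤ S.count h
    · obtain ⟨h, hh⟩ := hh
      have hval : (univ.filter (fun h => n ≤ S.count h)).val ≤ S := by
        rw [Finset.val_le_iff_val_subset]
        intro a ha
        have : n ≤ S.count a := (Finset.mem_filter.1 (show a ∈ univ.filter (fun h => n ≤ S.count h) from ha)).2
        exact Multiset.count_pos.1 (by omega)
      refine ⟨univ.filter (fun h => n ≤ S.count h), ⟨h, by simpa using hh⟩, hval, ?_, ?_, ?_⟩
      · refine le_trans ?_ (Multiset.count_le_card h _)
        rw [Multiset.count_sub]
        have := Multiset.nodup_iff_count_le_one.1 (univ.filter (fun h => n ≤ S.count h)).nodup h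
        omega
      · intro h hh; simpa using hh
      · left; intro a ha; simpa using ha
    · push Not at hh
      obtain ⟨a, ha⟩ := Multiset.card_pos_iff_exists_mem.1 (by omega : 0 < S.card)
      have hval : ({a} : Finset G).val ≤ S := by simpa using ha
      refine ⟨{a}, by simp, hval, ?_, ?_, ?_⟩
      · rw [Multiset.card_sub hval]; simp; omega
      · intro h h1; have := hh h; omega
      · right; refine ⟨by simp, ?_⟩
        intro h; have := hh h; omega
  obtain ⟨hAne, hAS, hAc, hheavy, hor⟩ := hA
  have hAcard : 0 < A.card := Finset.card_pos.2 hAne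
  have hlt : (S - A.val).card < S.card := by
    rw [Multiset.card_sub hAS]
    have := Multiset.card_le_card hAS
    simp only [Finset.card_val] at *
    omega
  have hYne := sig_nonempty hAc
  have hXne : (A + sig (S - A.val) (n - 1)).Nonempty := hAne.add hYne
  refine ⟨A + sig (S - A.val) (n - 1), dstab (A + sig (S - A.val) (n - 1)), ?_, hXne, le_rfl, ?_⟩
  · have hA1 : A ⊆ sig A.val 1 := by
      intro a ha
      exact mem_sig.2 ⟨{a}, by simpa using ha, by simp, by simp⟩
    refine (Finset.add_subset_add_right hA1).trans ((sig_add _ _).trans ?_)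
    rw [add_tsub_cancel_of_le hAS]
    rw [show 1 + (n - 1) = n by omega]
  · set K := dstab (A + sig (S - A.val) (n - 1)) with hK
    have e0 : A + sig (S - A.val) (n - 1) + LF K = A + sig (S - A.val) (n - 1) :=
      add_LF_eq le_rfl
    have k1 := kneser_rel (L := K) hAne hYne (by rw [e0])
    rw [e0] at k1
    have k2 := hR _ hlt (n - 1) K (by omega) hAc (by
      refine (dstab_le_add _ A).trans ?_
      rw [add_right_comm, add_comm (sig _ _) A, e0])
    have k3 : (A + LF K).card = ∑ g : G, (if ∃ a ∈ A, (a : G ⧸ K) = g then 1 else 0) := by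
      rw [← Finset.card_filter]
      congr 1
      ext g
      rw [mem_add_LF]; simp
    have hpt : ∀ g : G, mK n S K g ≤ (if ∃ a ∈ A, (a : G ⧸ K) = g then 1 else 0) +
        min (n - 1) (nn K (S - A.val) g) := by
      intro g
      have hadd : nn K S g = nn K A.val g + nn K (S - A.val) g := by
        rw [← nn_add, add_tsub_cancel_of_le hAS]
      unfold mK
      split_ifs with c1 c2 c2
      · obtain ⟨h, hg, hc⟩ := c1
        have b1 : n - 1 ≤ nn K (S - A.val) g := by
          rw [← nn_congr _ hg]
          refine le_trans ?_ (count_le_nn K _ h)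
          rw [Multiset.count_sub]
          have := Multiset.nodup_iff_count_le_one.1 A.nodup h
          omega
        omega
      · obtain ⟨h, hg, hc⟩ := c1
        exact absurd ⟨h, hheavy h hc, hg⟩ c2
      · rcases hor with ho | ⟨ho, -⟩
        · obtain ⟨a, ha, hag⟩ := c2
          exact absurd ⟨a, hag, ho a ha⟩ c1
        · have b1 : nn K A.val g ≤ 1 := by
            refine (nn_le_card _ _ _).trans ?_
            rw [Finset.card_val, ho]
          omega
      · have b1 : nn K A.val g = 0 := by
          rw [nn, Multiset.card_eq_zero, Multiset.filter_eq_nil]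
          intro a ha hag
          exact c2 ⟨a, ha, hag⟩
        omega
    have htot := Finset.sum_le_sum (fun g (_ : g ∈ (univ : Finset G)) => hpt g)
    simp only [Finset.sum_add_distrib] at htot
    rw [← k3] at htot
    have e5 : n * (LF K).card = (n - 1) * (LF K).card + (LF K).card := by
      obtain ⟨m, rfl⟩ : ∃ m, n = m + 1 := ⟨n - 1, by omega⟩
      simp; ring
    omega

theorem AP_step {S : Multiset G} (hR : ∀ S' : Multiset G, S'.card < S.card → RAP S')
    {n : ℕ} (hn : 1 ≤ n) (hnS : n ≤ S.card) (hst : dstab (sig S n) = ⊥) :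
    1 + ∑ g : G, min n (S.count g) ≤ (sig S n).card + n := by
  rcases Nat.eq_or_lt_of_le hn with rfl | hn2
  · have : ∑ g : G, min 1 (S.count g) ≤ (sig S 1).card := by
      have e : ∀ g : G, min 1 (S.count g) = if g ∈ S then 1 else 0 := by
        intro g
        split_ifs with h
        · have := Multiset.count_pos.2 h; omega
        · rw [Multiset.count_eq_zero.2 h]; rfl
      simp only [e]
      rw [← Finset.card_filter]
      apply Finset.card_le_card
      intro g hg
      exact mem_sig.2 ⟨{g}, by simpa using hg, by simp, by simp⟩
    omega
  · have hne : (((univ : Finset (Finset G))).filter (fun C => ∃ K, Conv S n C K)).Nonempty := by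
      obtain ⟨C, K, h⟩ := conv_init hR hn2 hnS
      exact ⟨C, Finset.mem_filter.2 ⟨Finset.mem_univ _, K, h⟩⟩
    obtain ⟨C, hC, hmax⟩ := Finset.exists_max_image _ Finset.card hne
    obtain ⟨K, hK⟩ := (Finset.mem_filter.1 hC).2
    have hall : sig S n ⊆ C := by
      intro x hx
      by_contra hxC
      obtain ⟨C', L, h1, h2⟩ := conv_step hR hn hK hx hxC
      have := hmax C' (Finset.mem_filter.2 ⟨Finset.mem_univ _, L, h1⟩)
      omega
    have heq : C = sig S n := Finset.Subset.antisymm hK.1 hall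
    obtain ⟨-, -, h3, h4⟩ := hK
    rw [heq, hst, le_bot_iff] at h3
    subst h3
    have hc : (LF (⊥ : AddSubgroup G)).card = 1 := by
      rw [Finset.card_eq_one]
      exact ⟨0, by ext x; rw [mem_LF]; simp⟩
    rw [hc, heq, mul_one] at h4
    refine le_trans (Nat.add_le_add_left (Finset.sum_le_sum ?_) 1) h4
    intro g _
    unfold mK
    rw [nn_bot]
    split_ifs with h
    · exact min_le_left _ _
    · have : ¬ n ≤ S.count g := fun h' => h ⟨g, rfl, h'⟩
      omega

theorem AP_all (N : ℕ) : ∀ (G : Type u) [AddCommGroup G] [Fintype G] (S : Multiset G) (n : ℕ),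
    S.card < N → 1 ≤ n → n ≤ S.card → dstab (sig S n) = ⊥ →
    1 + ∑ g : G, min n (S.count g) ≤ (sig S n).card + n := by
  induction N with
  | zero => intro G _ _ S n h; omega
  | succ N ih =>
    intro G _ _ S n h h1 h2 h3
    refine AP_step ?_ h1 h2 h3
    intro S' hS'
    apply RAP_of_quot
    intro H inst n h1 h2 h3
    have key := ih (G ⧸ H) (S'.map (fun g : G => (g : G ⧸ H))) n
      (by rw [Multiset.card_map]; omega) h1 (by rw [Multiset.card_map]; exact h2) h3
    convert key

theorem RAP_all (S : Multiset G) : RAP S := by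
  apply RAP_of_quot
  intro H inst n h1 h2 h3
  have key := AP_all (S.card + 1) (G ⧸ H) (S.map (fun g : G => (g : G ⧸ H))) n
    (by rw [Multiset.card_map]; omega) h1 (by rw [Multiset.card_map]; exact h2) h3
  convert key
end DGM3

section DGM4
open Finset
open scoped Pointwise
open scoped Classical
variable {G : Type u} [AddCommGroup G]

theorem sig_compl {S : Multiset G} {m n : ℕ} (h : S.card = m + n) {x : G} (hx : x ∈ sig S n) :
    S.sum - x ∈ sig S m := by
  obtain ⟨T, hT, h1, rfl⟩ := mem_sig.1 hx
  refine mem_sig.2 ⟨S - T, tsub_le_self, ?_, ?_⟩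
  · rw [Multiset.card_sub hT]; omega
  · have : (S - T).sum + T.sum = S.sum := by
      rw [← Multiset.sum_add, tsub_add_cancel_of_le hT]
    rw [← this]; simp

variable [Fintype G]

theorem core_bound {S : Multiset G} {n k : ℕ} (hS : S.card = Fintype.card G + n) (hn : 1 ≤ n)
    (hk1 : 1 ≤ k) (hk : k ≤ (univ.filter (fun g => g ∈ S)).card)
    (hmult : ∀ g : G, S.count g ≤ Fintype.card G - k + 2)
    (h0 : S.sum ∉ sig S n) : n + k - 1 ≤ (sig S n).card := by
  obtain ⟨H, hH⟩ : ∃ H, H = dstab (sig S n) := ⟨_, rfl⟩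
  have hX : sig S n + LF H = sig S n := add_LF_eq hH.le
  have hmain := RAP_all S n H hn (by omega) (by rw [hX, hH])
  rw [hX] at hmain
  have hpos : 0 < (LF H).card := LF_pos H
  have hkm : k ≤ Fintype.card G := hk.trans (Finset.card_le_univ _)
  have hXm : (sig S n).card ≤ Fintype.card G := Finset.card_le_univ _
  have hsum := sum_nn H S
  set h := (LF H).card with hh
  by_cases hb : ∃ g, n ≤ nn H S g
  swap
  · push Not at hb
    have e : ∑ g : G, min n (nn H S g) = ∑ g : G, nn H S g :=
      Finset.sum_congr rfl (fun g _ => min_eq_right (hb g).le)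
    rw [e, hsum, hS, add_mul] at hmain
    have : Fintype.card G ≤ Fintype.card G * h := Nat.le_mul_of_pos_right _ hpos
    omega
  obtain ⟨a, ha⟩ := hb
  have hsupp : ∀ g, g ∈ S → 1 ≤ nn H S g := by
    intro g hg
    have := count_le_nn H S g
    have := Multiset.count_pos.2 hg
    omega
  have hca := card_coset H a
  by_cases hc : ∃ b : G, (a : G ⧸ H) ≠ b ∧ n ≤ nn H S b
  · obtain ⟨b, hab, hb⟩ := hc
    have hcb := card_coset H b
    have hpt : ∀ g : G, (if g ∈ S then 1 else 0) + (if (a : G ⧸ H) = g then (n - 1) else 0)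
        + (if (b : G ⧸ H) = g then (n - 1) else 0) ≤ min n (nn H S g) := by
      intro g
      have h1 := hsupp g
      by_cases hga : (a : G ⧸ H) = g
      · have hgb : ¬ (b : G ⧸ H) = g := fun h' => hab (hga.trans h'.symm)
        rw [nn_congr S hga] at ha
        rw [if_pos hga, if_neg hgb]
        split_ifs <;> omega
      · by_cases hgb : (b : G ⧸ H) = g
        · rw [nn_congr S hgb] at hb
          rw [if_neg hga, if_pos hgb]
          split_ifs <;> omega
        · rw [if_neg hga, if_neg hgb]
          split_ifs with hgS
          · have := h1 hgS; omega
          · omega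
    have htot := Finset.sum_le_sum (fun g (_ : g ∈ (univ : Finset G)) => hpt g)
    simp only [Finset.sum_add_distrib] at htot
    rw [← Finset.card_filter, ← Finset.sum_filter, ← Finset.sum_filter, Finset.sum_const,
      Finset.sum_const, hca, hcb, smul_eq_mul] at htot
    obtain ⟨p, rfl⟩ : ∃ p, n = p + 1 := ⟨n - 1, by omega⟩
    simp only [Nat.add_sub_cancel] at htot
    have e1 : (p + 1) * h = h * p + h := by ring
    have e2 : p ≤ h * p := Nat.le_mul_of_pos_left _ hpos
    rw [← hh] at htot
    omega
  · push Not at hc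
    obtain ⟨e, he⟩ : ∃ e, S.card = nn H S a + e := ⟨S.card - nn H S a, by
      have := nn_le_card H S a; omega⟩
    have hpt : ∀ g : G, nn H S g + (if (a : G ⧸ H) = g then n else 0) ≤
        min n (nn H S g) + (if (a : G ⧸ H) = g then nn H S a else 0) := by
      intro g
      by_cases hga : (a : G ⧸ H) = g
      · rw [if_pos hga, if_pos hga, ← nn_congr S hga]; omega
      · have := hc g hga
        rw [if_neg hga, if_neg hga]; omega
    have htot := Finset.sum_le_sum (fun g (_ : g ∈ (univ : Finset G)) => hpt g)
    simp only [Finset.sum_add_distrib] at htot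
    rw [← Finset.sum_filter, ← Finset.sum_filter, Finset.sum_const,
      Finset.sum_const, hca, smul_eq_mul, smul_eq_mul, hsum, ← hh, he, add_mul,
      mul_comm (nn H S a) h, mul_comm h n] at htot
    have hXe : h + e * h ≤ (sig S n).card := by omega
    by_cases h1 : h = 1
    · have hbot : H = ⊥ := by
        rw [eq_bot_iff]
        intro z hz
        rw [hh, Finset.card_eq_one] at h1
        obtain ⟨w, hw⟩ := h1
        have z1 : z ∈ LF H := mem_LF.2 hz
        have z2 : (0 : G) ∈ LF H := mem_LF.2 H.zero_mem
        rw [hw, Finset.mem_singleton] at z1 z2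
        rw [AddSubgroup.mem_bot, z1, z2]
      rw [hbot, nn_bot] at he
      have := hmult a
      rw [h1] at hXe
      omega
    · have hen : n + 1 ≤ e := by
        by_contra hcon
        have hen : e ≤ n := by omega
        apply h0
        set A := S.filter (fun s : G => (s : G ⧸ H) = a) with hA
        have hAc : A.card = nn H S a := rfl
        obtain ⟨B, hB, hBc⟩ : ∃ B ≤ A, B.card = Fintype.card G := by
          have : 0 < (A.powersetCard (Fintype.card G)).card := by
            rw [Multiset.card_powersetCard]; exact Nat.choose_pos (by omega)
          obtain ⟨T, hT⟩ := Multiset.card_pos_iff_exists_mem.1 this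
          rw [Multiset.mem_powersetCard] at hT
          exact ⟨T, hT⟩
        have hBS : B ≤ S := hB.trans (Multiset.filter_le _ _)
        have hx : S.sum - B.sum ∈ sig S n :=
          sig_compl (m := n) (n := Fintype.card G) (by omega) (mem_sig.2 ⟨B, hBS, hBc, rfl⟩)
        have hBmk : ((B.sum : G) : G ⧸ H) = Fintype.card G • (a : G ⧸ H) :=
          mk_sig (S := A) (n := Fintype.card G) (fun s hs => (Multiset.mem_filter.1 hs).2)
            (mem_sig.2 ⟨B, hB, hBc, rfl⟩)
        rw [← QuotientAddGroup.mk_nsmul, card_nsmul_eq_zero] at hBmk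
        refine mem_of_mk_eq (K := H) hH.le hx ?_
        rw [QuotientAddGroup.mk_sub, hBmk, QuotientAddGroup.mk_zero, sub_zero]
      have hke : k ≤ h + e := by
        refine hk.trans ?_
        have hsub : univ.filter (fun g => g ∈ S) ⊆ univ.filter (fun g : G => (a : G ⧸ H) = g) ∪
            (S.filter (fun s : G => ¬ (s : G ⧸ H) = a)).toFinset := by
          intro g hg
          have hg := (Finset.mem_filter.1 hg).2
          rw [Finset.mem_union]
          by_cases hga : (a : G ⧸ H) = g
          · left; exact Finset.mem_filter.2 ⟨Finset.mem_univ _, hga⟩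
          · right; rw [Multiset.mem_toFinset, Multiset.mem_filter]
            exact ⟨hg, fun h' => hga h'.symm⟩
        refine (Finset.card_le_card hsub).trans ((Finset.card_union_le _ _).trans ?_)
        rw [hca]
        have h3 := Multiset.toFinset_card_le (S.filter (fun s : G => ¬ (s : G ⧸ H) = a))
        have h4 := congrArg Multiset.card
          (Multiset.filter_add_not (fun s : G => (s : G ⧸ H) = a) S)
        rw [Multiset.card_add] at h4
        have h5 : nn H S a = (S.filter (fun s : G => (s : G ⧸ H) = a)).card := rfl
        omega
      have h2 : 2 ≤ h := by omega
      have : e * 2 ≤ e * h := Nat.mul_le_mul_left _ h2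
      omega
end DGM4

theorem subsums_ncard {G : Type*} [AddCommGroup G] (S : Multiset G) (m : ℕ) :
    ({x | ∃ T ≤ S, Multiset.card T = m ∧ T.sum = x} : Set G).ncard = (sig S m).card := by
  rw [← Set.ncard_coe_finset]
  congr 1
  ext x
  rw [Finset.mem_coe, mem_sig]
  rfl

theorem core_final {G : Type*} [AddCommGroup G] [Fintype G] [DecidableEq G]
    (S : Multiset G) (hS : Fintype.card G + 1 ≤ Multiset.card S)
    (k : ℕ) (hk1 : 1 ≤ k) (hk : k ≤ S.toFinset.card)
    (hmult : ∀ g : G, S.count g ≤ Fintype.card G - k + 2)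
    (h0 : (0 : G) ∉ sig S (Fintype.card G)) :
    Multiset.card S - Fintype.card G + k - 1 ≤ (sig S (Fintype.card G)).card := by
  obtain ⟨n, hn⟩ : ∃ n, S.card = Fintype.card G + n := ⟨S.card - Fintype.card G, by omega⟩
  have hb : n + k - 1 ≤ (sig S n).card := by
    refine core_bound hn (by omega) hk1 ?_ ?_ ?_
    · convert hk using 2
      ext g; simp
    · intro g; convert hmult g
    · intro h
      apply h0
      have := sig_compl hn h
      rwa [sub_self] at this
  have hle : (sig S n).card ≤ (sig S (Fintype.card G)).card :=
    Finset.card_le_card_of_injOn (fun x => S.sum - x) (fun x hx => sig_compl hn hx)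
      (fun x _ y _ hxy => by simpa using hxy)
  omega


theorem stmt_8 {G : Type*} [AddCommGroup G] [Fintype G] [DecidableEq G]
    (S : Multiset G) (hS : Fintype.card G + 1 ≤ Multiset.card S)
    (k : ℕ) (hk1 : 1 ≤ k) (hk : k ≤ S.toFinset.card)
    (hmult : ∀ g : G, S.count g ≤ Fintype.card G - k + 2)
    (h0 : (0 : G) ∉ subsums S (Fintype.card G)) :
    Multiset.card S - Fintype.card G + k - 1 ≤ (subsums S (Fintype.card G)).ncard := by
  have e := subsums_ncard S (Fintype.card G)
  change (subsums S (Fintype.card G)).ncard = _ at e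
  rw [e]
  refine core_final S hS k hk1 hk hmult ?_
  intro h
  exact h0 (mem_sig.1 h)
end

section
/- Let G = C_n ⊕ C_n with n ≥ 2 and let S be a minimal zero-sum sequence over G of length |S| = 2n−1. Then every element g occurring in S has order n. -/
/-- A minimal zero-sum sequence: nonempty, sum zero, and no proper nonempty
subsequence has sum zero. -/
def IsMinZeroSum {G : Type*} [AddCommGroup G] (S : Multiset G) : Prop :=
  S ≠ 0 ∧ S.sum = 0 ∧ ∀ T ≤ S, T ≠ 0 → T ≠ S → T.sum ≠ 0

open Finset MvPolynomial in
/-- Chevalley-Warning bound for the Davenport constant of `C_p^d`. -/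
theorem davenport_prime {ι : Type*} {p d : ℕ} (hp : p.Prime) (a : Fin d → ι → ℤ)
    (s : Finset ι) (hs : d * (p - 1) < #s) :
    ∃ t ⊆ s, t.Nonempty ∧ ∀ k, (p : ℤ) ∣ ∑ i ∈ t, a k i := by
  classical
  haveI : Fact p.Prime := ⟨hp⟩
  let f : Fin d → MvPolynomial s (ZMod p) := fun k => ∑ i : s, (a k i : ZMod p) • X i ^ (p - 1)
  have hdeg : ∑ k, (f k).totalDegree < Fintype.card s := by
    calc ∑ k, (f k).totalDegree ≤ ∑ _k : Fin d, (p - 1) := by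
          apply Finset.sum_le_sum
          intro k _
          apply totalDegree_finsetSum_le
          intro i _
          exact (totalDegree_smul_le ..).trans (totalDegree_X_pow ..).le
      _ = d * (p - 1) := by simp
      _ < Fintype.card s := by simpa using hs
  have hpN := char_dvd_card_solutions_of_fintype_sum_lt p hdeg
  have hp1 : p - 1 ≠ 0 := by have := hp.two_le; omega
  let z : {x : s → ZMod p // ∀ k, eval x (f k) = 0} := ⟨0, by intro k; simp [f, hp1]⟩
  rw [← @Nat.card_eq_fintype_card _ (_)] at hpN
  have hN0 : 0 < Nat.card {x : s → ZMod p // ∀ k, eval x (f k) = 0} :=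
    @Nat.card_pos _ ⟨z⟩ _
  have hlt := hp.one_lt.trans_le <| Nat.le_of_dvd hN0 hpN
  rw [Nat.card_eq_fintype_card] at hlt
  obtain ⟨x, hx⟩ := @Fintype.exists_ne_of_one_lt_card _ _ hlt z
  refine ⟨({i | x.1 i ≠ 0} : Finset s).map ⟨(↑), Subtype.val_injective⟩, ?_, ?_, ?_⟩
  · simp +contextual [subset_iff]
  · rw [← Subtype.coe_ne_coe, Function.ne_iff] at hx
    obtain ⟨i, hi⟩ := hx
    rw [Finset.map_nonempty]
    exact ⟨i, Finset.mem_filter.2 ⟨Finset.mem_univ _, hi⟩⟩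
  · intro k
    rw [← ZMod.intCast_zmod_eq_zero_iff_dvd]
    have := x.2 k
    simpa [f, ZMod.pow_card_sub_one, Finset.sum_filter] using this

open Finset in
/-- `η(C_p^2) ≤ 3p-2`. -/
theorem eta_prime {ι : Type*} {p : ℕ} (hp : p.Prime) (a : Fin 2 → ι → ℤ)
    (s : Finset ι) (hs : 3 * p ≤ #s + 2) :
    ∃ t ⊆ s, t.Nonempty ∧ #t ≤ p ∧ ∀ k, (p : ℤ) ∣ ∑ i ∈ t, a k i := by
  classical
  have h2 := hp.two_le
  obtain ⟨s', hs's, hs'⟩ := Finset.exists_subset_card_eq (s := s) (n := 3 * p - 2) (by omega)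
  obtain ⟨t, hts, htn, ht⟩ := davenport_prime (d := 3) hp
    (Fin.cons (fun _ => 1) a : Fin 3 → ι → ℤ) s' (by omega)
  have hcard : p ∣ #t := by
    have := ht 0
    simp only [Fin.cons_zero, sum_const, nsmul_eq_mul, mul_one] at this
    exact_mod_cast this
  have hta : ∀ k, (p : ℤ) ∣ ∑ i ∈ t, a k i := fun k => by
    have := ht k.succ
    simpa only [Fin.cons_succ] using this
  have hle : #t ≤ 3 * p - 2 := hs' ▸ card_le_card hts
  have hpos := htn.card_pos
  obtain ⟨c, hc⟩ := hcard
  have hc3 : c < 3 := by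
    by_contra h
    have : p * 3 ≤ p * c := Nat.mul_le_mul_left p (by omega)
    omega
  interval_cases c
  · omega
  · exact ⟨t, hts.trans hs's, htn, by omega, hta⟩
  · obtain ⟨t', ht't, ht'⟩ := Finset.exists_subset_card_eq (s := t) (n := 2 * p - 1) (by omega)
    obtain ⟨u, hut, hun, hu⟩ := davenport_prime hp a t' (by omega)
    have hut2 := hut.trans ht't
    by_cases h : #u ≤ p
    · exact ⟨u, (hut2.trans hts).trans hs's, hun, h, hu⟩
    · have h1 := card_sdiff_add_card_eq_card hut2
      have h3 := card_le_card hut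
      refine ⟨t \ u, (sdiff_subset.trans hts).trans hs's, ?_, by omega, ?_⟩
      · rw [← card_pos]; omega
      · intro k
        have h4 := Finset.sum_sdiff (f := a k) hut2
        have h5 := hta k
        rw [← h4] at h5
        exact (Int.dvd_add_left (hu k)).1 h5

open Finset in
/-- Extraction of many disjoint short subsequences with sum zero modulo `p`. -/
theorem extract_family {ι : Type*} [DecidableEq ι] {p : ℕ} (hp : p.Prime) (a : Fin 2 → ι → ℤ) (m : ℕ)
    (s : Finset ι) (hs : m * p + 2 * p ≤ #s + 2) :
    ∃ P : Finset (Finset ι), #P = m ∧ (P : Set (Finset ι)).Pairwise Disjoint ∧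
      ∀ t ∈ P, t ⊆ s ∧ t.Nonempty ∧ #t ≤ p ∧ ∀ k, (p : ℤ) ∣ ∑ i ∈ t, a k i := by
  induction m generalizing s with
  | zero => exact ⟨∅, by simp⟩
  | succ m ih =>
    have hs2 : m * p + 3 * p ≤ #s + 2 := by linarith [hs, Nat.succ_mul m p]
    obtain ⟨t, hts, htn, htp, ht⟩ := eta_prime hp a s (by omega)
    have h1 := card_sdiff_add_card_eq_card hts
    obtain ⟨P, hPc, hPd, hP⟩ := ih (s \ t) (by omega)
    have hdis : ∀ u ∈ P, Disjoint t u := fun u hu =>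
      disjoint_sdiff.mono_right (hP u hu).1
    have htP : t ∉ P := fun h => htn.ne_empty (disjoint_self.1 (hdis t h))
    refine ⟨insert t P, by rw [card_insert_of_notMem htP, hPc], ?_, ?_⟩
    · rw [coe_insert]
      exact hPd.insert fun u hu _ => ⟨hdis u hu, (hdis u hu).symm⟩
    · intro u hu
      rcases mem_insert.1 hu with rfl | hu
      · exact ⟨hts, htn, htp, ht⟩
      · obtain ⟨h1, h2⟩ := hP u hu
        exact ⟨h1.trans sdiff_subset, h2⟩

open Finset in
/-- Combining subsequences with sum zero modulo `p` into one with sum zero modulo `p * q`. -/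
theorem combine_family {ι : Type*} [DecidableEq ι] {p q : ℕ} (hp : p.Prime) (a : Fin 2 → ι → ℤ)
    (P : Finset (Finset ι)) (hPd : (P : Set (Finset ι)).Pairwise Disjoint)
    (hP : ∀ t ∈ P, t.Nonempty ∧ ∀ k, (p : ℤ) ∣ ∑ i ∈ t, a k i)
    (hD : ∀ b : Fin 2 → Finset ι → ℤ, ∃ Q ⊆ P, Q.Nonempty ∧ ∀ k, (q : ℤ) ∣ ∑ t ∈ Q, b k t) :
    ∃ Q ⊆ P, (Q.biUnion id).Nonempty ∧
      ∀ k, ((p * q : ℕ) : ℤ) ∣ ∑ i ∈ Q.biUnion id, a k i := by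
  obtain ⟨Q, hQP, hQn, hQ⟩ := hD fun k t => (∑ i ∈ t, a k i) / p
  refine ⟨Q, hQP, ?_, ?_⟩
  · obtain ⟨t, ht⟩ := hQn
    obtain ⟨i, hi⟩ := (hP t (hQP ht)).1
    exact ⟨i, mem_biUnion.2 ⟨t, ht, hi⟩⟩
  · intro k
    have hd : (Q : Set (Finset ι)).PairwiseDisjoint id := fun x hx y hy hxy =>
      hPd (hQP hx) (hQP hy) hxy
    rw [sum_biUnion hd]
    have : ∑ t ∈ Q, ∑ i ∈ id t, a k i = p * ∑ t ∈ Q, (∑ i ∈ t, a k i) / p := by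
      rw [mul_sum]
      exact sum_congr rfl fun t ht => (Int.mul_ediv_cancel' ((hP t (hQP ht)).2 k)).symm
    rw [this]
    push_cast
    exact mul_dvd_mul_left _ (hQ k)

open Finset in
/-- `D(C_n^2) ≤ 2n-1`. -/
theorem davenport_sq {ι : Type*} (n : ℕ) (hn : 0 < n) (a : Fin 2 → ι → ℤ)
    (s : Finset ι) (hs : 2 * n ≤ #s + 1) :
    ∃ t ⊆ s, t.Nonempty ∧ ∀ k, (n : ℤ) ∣ ∑ i ∈ t, a k i := by
  classical
  induction n using induction_on_primes generalizing ι with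
  | zero => omega
  | one => exact ⟨s, subset_rfl, by rw [← card_pos]; omega, by simp⟩
  | prime_mul p q hp ih =>
    have hq : 0 < q := Nat.pos_of_mul_pos_left hn
    have h2 := hp.two_le
    obtain ⟨r, rfl⟩ : ∃ r, q = r + 1 := ⟨q - 1, by omega⟩
    have hs' : 2 * r * p + 2 * p ≤ #s + 1 := by linarith [hs, show 2 * (p * (r + 1)) = 2 * r * p + 2 * p by ring]
    obtain ⟨P, hPc, hPd, hP⟩ := extract_family hp a (2 * r) s (by omega)
    have hbig : #(P.biUnion id) ≤ 2 * r * p := by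
      rw [← hPc]
      exact card_biUnion_le_card_mul _ _ _ fun t ht => (hP t ht).2.2.1
    have hsub : P.biUnion id ⊆ s := biUnion_subset.2 fun t ht => (hP t ht).1
    have h1 := card_sdiff_add_card_eq_card hsub
    obtain ⟨t, hts, htn, ht⟩ := davenport_prime hp a (s \ P.biUnion id) (by omega)
    have hdis : ∀ u ∈ P, Disjoint t u := fun u hu =>
      (disjoint_sdiff.symm.mono_left hts).mono_right (subset_biUnion_of_mem id hu)
    have htP : t ∉ P := fun h => htn.ne_empty (disjoint_self.1 (hdis t h))
    obtain ⟨Q, hQP, hQn, hQ⟩ := combine_family (q := r + 1) hp a (insert t P)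
      (by
        rw [coe_insert]
        exact hPd.insert fun u hu _ => ⟨hdis u hu, (hdis u hu).symm⟩)
      (by
        intro u hu
        rcases mem_insert.1 hu with rfl | hu
        · exact ⟨htn, ht⟩
        · exact ⟨(hP u hu).2.1, (hP u hu).2.2.2⟩)
      (fun b => ih hq b (insert t P) (by rw [card_insert_of_notMem htP, hPc]; omega))
    refine ⟨_, ?_, hQn, hQ⟩
    refine biUnion_subset.2 fun u hu => ?_
    rcases mem_insert.1 (hQP hu) with rfl | hu
    · exact hts.trans sdiff_subset
    · exact (hP u hu).1

open Finset in
/-- Key step: if some element is divisible by `p`, there is a short zero-sum subsequence. -/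
theorem key_step {ι : Type*} [DecidableEq ι] {p q : ℕ} (hp : p.Prime) (hq : 0 < q)
    (a : Fin 2 → ι → ℤ) (s : Finset ι) (hs : #s + 1 = 2 * (p * q)) (g : ι) (hg : g ∈ s)
    (hgp : ∀ k, (p : ℤ) ∣ a k g) :
    ∃ t ⊆ s, t.Nonempty ∧ #t < #s ∧ ∀ k, ((p * q : ℕ) : ℤ) ∣ ∑ i ∈ t, a k i := by
  have h2 := hp.two_le
  obtain ⟨r, rfl⟩ : ∃ r, q = r + 1 := ⟨q - 1, by omega⟩
  have hs' : #s + 1 = 2 * r * p + 2 * p := by rw [hs]; ring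
  have he := card_erase_add_one hg
  obtain ⟨P, hPc, hPd, hP⟩ := extract_family hp a (2 * r) (s.erase g) (by omega)
  have hbig : #(P.biUnion id) ≤ 2 * r * p := by
    rw [← hPc]
    exact card_biUnion_le_card_mul _ _ _ fun t ht => (hP t ht).2.2.1
  have hdis : ∀ u ∈ P, Disjoint {g} u := fun u hu => by
    rw [disjoint_singleton_left]
    exact fun h => notMem_erase g s ((hP u hu).1 h)
  have htP : {g} ∉ P := fun h => (singleton_ne_empty g) (disjoint_self.1 (hdis _ h))
  obtain ⟨Q, hQP, hQn, hQ⟩ := combine_family (q := r + 1) hp a (insert {g} P)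
    (by
      rw [coe_insert]
      exact hPd.insert fun u hu _ => ⟨hdis u hu, (hdis u hu).symm⟩)
    (by
      intro u hu
      rcases mem_insert.1 hu with rfl | hu
      · exact ⟨singleton_nonempty g, by simpa using hgp⟩
      · exact ⟨(hP u hu).2.1, (hP u hu).2.2.2⟩)
    (fun b => davenport_sq _ hq b (insert {g} P) (by rw [card_insert_of_notMem htP, hPc]; omega))
  refine ⟨_, ?_, hQn, ?_, hQ⟩
  · refine biUnion_subset.2 fun u hu => ?_
    rcases mem_insert.1 (hQP hu) with rfl | hu
    · simpa using hg
    · exact (hP u hu).1.trans (erase_subset _ _)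
  · have h3 : Q.biUnion id ⊆ {g} ∪ P.biUnion id := by
      refine (biUnion_subset_biUnion_of_subset_left id hQP).trans ?_
      rw [biUnion_insert]; rfl
    have h4 := card_le_card h3
    have h5 := card_union_le {g} (P.biUnion id)
    rw [card_singleton] at h5
    omega

theorem stmt_13 (n : ℕ) (hn : 2 ≤ n) (S : Multiset (ZMod n × ZMod n))
    (hmin : IsMinZeroSum S) (hlen : Multiset.card S = 2 * n - 1) :
    ∀ g ∈ S, addOrderOf g = n := by
  classical
  intro g hg
  by_contra hne
  haveI : NeZero n := ⟨by omega⟩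
  have hng : n • g = 0 := by ext <;> simp
  obtain ⟨c, hc⟩ := addOrderOf_dvd_of_nsmul_eq_zero hng
  have hc1 : c ≠ 1 := by rintro rfl; omega
  obtain ⟨p, hp, d, rfl⟩ := Nat.exists_prime_and_dvd hc1
  obtain ⟨q, hq⟩ : ∃ q, q = addOrderOf g * d := ⟨_, rfl⟩
  have hnpq : n = p * q := by rw [hc, hq]; ring
  have hqg : q • g = 0 := by rw [hq, mul_comm, mul_nsmul', addOrderOf_nsmul_eq_zero, nsmul_zero]
  have hq0 : 0 < q := by
    rcases Nat.eq_zero_or_pos q with h | h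
    · subst h; omega
    · exact h
  have key : ∀ x : ZMod n, q • x = 0 → (p : ℤ) ∣ (x.val : ℤ) := by
    intro x hx
    have h1 : ((q * x.val : ℕ) : ZMod n) = 0 := by
      push_cast
      rw [ZMod.natCast_zmod_val, ← nsmul_eq_mul, hx]
    rw [ZMod.natCast_eq_zero_iff] at h1
    have h2 : q * p ∣ q * x.val := by rwa [mul_comm q p, ← hnpq]
    exact_mod_cast Nat.dvd_of_mul_dvd_mul_left hq0 h2
  let a : Fin 2 → (ZMod n × ZMod n) × ℕ → ℤ := ![fun x => x.1.1.val, fun x => x.1.2.val]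
  have hcard := Multiset.card_toEnumFinset S
  obtain ⟨t, hts, htn, htc, ht⟩ := key_step hp hq0 a S.toEnumFinset (by omega) (g, 0)
    (by rw [Multiset.mem_toEnumFinset]; exact Multiset.count_pos.2 hg)
    (by
      intro k
      fin_cases k
      · exact key g.1 (congrArg Prod.fst hqg)
      · exact key g.2 (congrArg Prod.snd hqg))
  have h0 : ∑ i ∈ t, i.1 = 0 := by
    rw [← hnpq] at ht
    have e0 := ht 0
    have e1 := ht 1
    rw [← ZMod.intCast_zmod_eq_zero_iff_dvd] at e0 e1
    ext
    · rw [Prod.fst_sum]; simpa [a] using e0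
    · rw [Prod.snd_sum]; simpa [a] using e1
  refine hmin.2.2 (t.val.map Prod.fst) (Multiset.map_fst_le_of_subset_toEnumFinset hts) ?_ ?_ h0
  · intro h
    have := congrArg Multiset.card h
    simp at this
    exact htn.ne_empty this
  · intro h
    have := congrArg Multiset.card h
    rw [Multiset.card_map, Finset.card_val] at this
    omega
end

section
/- Let G = C_{mn} ⊕ C_{mn} with m, n ≥ 2, let S be a minimal zero-sum sequence over G of length 2mn−1, and let φ : G → G be multiplication by m. Then: φ(S) is not a product of 2m zero-sum subsequences; every zero-sum subsequence T of φ(S) with 1 ≤ |T| ≤ n has |T| = n; and 0 does not occur in φ(S). -/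
open Finset in
theorem aux_cw {κ ι : Type*} [Fintype κ] (p : ℕ) [Fact p.Prime] (c : κ → ι → ℤ) (I : Finset ι)
    (h : Fintype.card κ * (p - 1) < #I) :
    ∃ J ⊆ I, J.Nonempty ∧ ∀ k, (p : ℤ) ∣ ∑ i ∈ J, c k i := by
  classical
  have : NeZero p := inferInstance
  have hp1 : 1 < p := (Fact.out : p.Prime).one_lt
  let f : κ → MvPolynomial I (ZMod p) := fun k =>
    ∑ i : I, ((c k i : ℤ) : ZMod p) • MvPolynomial.X i ^ (p - 1)
  have hdeg : (∑ k, (f k).totalDegree) < Fintype.card I := by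
    calc _ ≤ ∑ k : κ, (p - 1) := by
          refine Finset.sum_le_sum fun k _ => ?_
          apply MvPolynomial.totalDegree_finsetSum_le
          rintro i _
          exact (MvPolynomial.totalDegree_smul_le ..).trans (MvPolynomial.totalDegree_X_pow ..).le
      _ < _ := by simpa using h
  have hpN := char_dvd_card_solutions_of_fintype_sum_lt p hdeg
  let zero_sol : {x // ∀ k, MvPolynomial.eval x (f k) = 0} :=
    ⟨0, by intro k; simp [f, map_sum, hp1, tsub_eq_zero_iff_le]⟩
  obtain ⟨x, hx⟩ := Fintype.exists_ne_of_one_lt_card (hp1.trans_le <|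
    Nat.le_of_dvd (@Fintype.card_pos _ _ ⟨zero_sol⟩) hpN) zero_sol
  refine ⟨({a | x.1 a ≠ 0} : Finset _).map ⟨(↑), Subtype.val_injective⟩, ?_, ?_, ?_⟩
  · simp +contextual [subset_iff]
  · rw [Finset.map_nonempty]
    rw [← Subtype.coe_ne_coe, Function.ne_iff] at hx
    exact hx.imp (fun a ha ↦ mem_filter.2 ⟨Finset.mem_attach _ _, ha⟩)
  · intro k
    rw [← ZMod.intCast_zmod_eq_zero_iff_dvd]
    simpa [f, ZMod.pow_card_sub_one, Finset.sum_filter] using x.2 k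

/-- nonempty, sums divisible by `n`. -/
def ZS {ι : Type*} (n : ℕ) (a b : ι → ℤ) (J : Finset ι) : Prop :=
  J.Nonempty ∧ (n : ℤ) ∣ ∑ i ∈ J, a i ∧ (n : ℤ) ∣ ∑ i ∈ J, b i

/-- Davenport property. -/
def PD.{u} (n : ℕ) : Prop := ∀ (ι : Type u) (a b : ι → ℤ) (I : Finset ι), 2 * n ≤ I.card + 1 →
  ∃ J ⊆ I, ZS n a b J

/-- eta property. -/
def PE.{u} (n : ℕ) : Prop := ∀ (ι : Type u) (a b : ι → ℤ) (I : Finset ι), 3 * n ≤ I.card + 2 →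
  ∃ J ⊆ I, ZS n a b J ∧ J.card ≤ n

theorem pd_prime.{u} (p : ℕ) (hp : p.Prime) : PD.{u} p := by
  intro ι a b I h
  haveI : Fact p.Prime := ⟨hp⟩
  obtain ⟨J, hJ, hne, hk⟩ := aux_cw p ![a, b] I (by
    have := hp.two_le; simp; omega)
  exact ⟨J, hJ, hne, hk 0, hk 1⟩

theorem zs_sdiff {ι : Type*} [DecidableEq ι] {n : ℕ} {a b : ι → ℤ} {J K : Finset ι}
    (hJ : ZS n a b J) (hK : ZS n a b K) (hKJ : K ⊆ J) (hne : K ≠ J) : ZS n a b (J \ K) := by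
  refine ⟨?_, ?_, ?_⟩
  · rw [Finset.sdiff_nonempty]
    exact fun h => hne (hKJ.antisymm h)
  · have := Finset.sum_sdiff (f := a) hKJ
    rw [eq_sub_of_add_eq this]; exact dvd_sub hJ.2.1 hK.2.1
  · have := Finset.sum_sdiff (f := b) hKJ
    rw [eq_sub_of_add_eq this]; exact dvd_sub hJ.2.2 hK.2.2

theorem pe_prime.{u} (p : ℕ) (hp : p.Prime) : PE.{u} p := by
  classical
  intro ι a b I h
  haveI : Fact p.Prime := ⟨hp⟩
  have h2 := hp.two_le
  obtain ⟨I', hI', hc⟩ := Finset.exists_subset_card_eq (s := I) (n := 3 * p - 2) (by omega)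
  obtain ⟨J, hJ, hne, hk⟩ := aux_cw p ![a, b, fun _ => 1] I' (by simp; omega)
  have hz : ZS p a b J := ⟨hne, hk 0, hk 1⟩
  have h3 := hk 2
  simp at h3
  obtain ⟨c, hc3⟩ : p ∣ J.card := by exact_mod_cast h3
  have hle := Finset.card_le_card hJ
  have hc2 : c ≤ 2 := by
    by_contra hcc
    have : p * 3 ≤ p * c := Nat.mul_le_mul_left _ (by omega)
    omega
  by_cases hc1 : c ≤ 1
  · refine ⟨J, hJ.trans hI', hz, ?_⟩
    have : p * c ≤ p * 1 := Nat.mul_le_mul_left _ hc1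
    omega
  have hc22 : c = 2 := by omega
  subst hc22
  obtain ⟨j, hj⟩ := hne
  have hce := Finset.card_erase_of_mem hj
  obtain ⟨K, hK, hKz⟩ := pd_prime p hp ι a b (J.erase j) (by omega)
  have hKJ : K ⊆ J := hK.trans (Finset.erase_subset _ _)
  have hKne : K ≠ J := by
    rintro rfl
    exact Finset.notMem_erase j K (hK hj)
  by_cases hKc : K.card ≤ p
  · exact ⟨K, hKJ.trans (hJ.trans hI'), hKz, hKc⟩
  · refine ⟨J \ K, Finset.sdiff_subset.trans (hJ.trans hI'), zs_sdiff hz hKz hKJ hKne, ?_⟩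
    have := Finset.card_sdiff_add_card_eq_card hKJ
    omega

/-- A family of disjoint zero-sum subsets. -/
def Fam {ι : Type*} (n : ℕ) (a b : ι → ℤ) (I : Finset ι) (F : Finset (Finset ι)) : Prop :=
  (F : Set (Finset ι)).PairwiseDisjoint id ∧ ∀ J ∈ F, J ⊆ I ∧ ZS n a b J

theorem fam_insert {ι : Type*} [DecidableEq ι] {n : ℕ} {a b : ι → ℤ} {I J : Finset ι}
    {F : Finset (Finset ι)} (hJI : J ⊆ I) (hJ : ZS n a b J) (hF : Fam n a b (I \ J) F) :
    Fam n a b I (insert J F) ∧ (insert J F).card = F.card + 1 := by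
  have hd : ∀ K ∈ F, Disjoint J K := fun K hK =>
    Finset.disjoint_of_subset_right (hF.2 K hK).1 Finset.disjoint_sdiff
  refine ⟨⟨?_, ?_⟩, ?_⟩
  · rw [Finset.coe_insert]
    exact hF.1.insert fun K hK _ => hd K hK
  · intro K hK
    rcases Finset.mem_insert.1 hK with rfl | hK
    · exact ⟨hJI, hJ⟩
    · exact ⟨(hF.2 K hK).1.trans Finset.sdiff_subset, (hF.2 K hK).2⟩
  · apply Finset.card_insert_of_notMem
    intro hm
    have := hd J hm
    rw [disjoint_self] at this
    exact hJ.1.ne_empty this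

theorem extract.{u} {n : ℕ} (hE : PE.{u} n) {ι : Type u} [DecidableEq ι] (a b : ι → ℤ) (k : ℕ) :
    ∀ I : Finset ι, 3 * n + k * n ≤ I.card + n + 2 →
    ∃ F, Fam n a b I F ∧ F.card = k ∧ (∀ J ∈ F, J.card ≤ n) := by
  induction k with
  | zero => intro I _; exact ⟨∅, by simp [Fam], by simp, by simp⟩
  | succ k ih =>
    intro I h
    have hr : (k + 1) * n = k * n + n := by ring
    obtain ⟨J, hJ, hz, hc⟩ := hE ι a b I (by omega)
    have := Finset.card_sdiff_add_card_eq_card hJ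
    obtain ⟨F, hF, hk, hs⟩ := ih (I \ J) (by omega)
    obtain ⟨h1, h2⟩ := fam_insert hJ hz hF
    refine ⟨_, h1, by omega, ?_⟩
    intro K hK
    rcases Finset.mem_insert.1 hK with rfl | hK
    · exact hc
    · exact hs K hK

/-- Like `extract`, followed by one more application of the Davenport property;
the last member can be taken inside any prescribed superset leftover. -/
theorem extract' {n : ℕ} {ι : Type*} [DecidableEq ι] {a b : ι → ℤ}
    {I : Finset ι} {F : Finset (Finset ι)} (hF : Fam n a b I F) {J : Finset ι}
    (hJ : J ⊆ I \ F.biUnion id) (hz : ZS n a b J) :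
    Fam n a b I (insert J F) ∧ (insert J F).card = F.card + 1 := by
  apply fam_insert (hJ.trans Finset.sdiff_subset) hz
  refine ⟨hF.1, fun K hK => ⟨?_, (hF.2 K hK).2⟩⟩
  intro x hx
  rw [Finset.mem_sdiff]
  refine ⟨(hF.2 K hK).1 hx, fun hxJ => ?_⟩
  have := hJ hxJ
  rw [Finset.mem_sdiff] at this
  exact this.2 (Finset.mem_biUnion.2 ⟨K, hK, hx⟩)

theorem combine {p q : ℕ} {ι : Type*} [DecidableEq ι] {a b : ι → ℤ}
    {I : Finset ι} {F : Finset (Finset ι)} (hF : Fam p a b I F) {V : Finset (Finset ι)}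
    (hV : V ⊆ F)
    (hz : ZS q (fun J => (∑ i ∈ J, a i) / (p : ℤ)) (fun J => (∑ i ∈ J, b i) / (p : ℤ)) V) :
    V.biUnion id ⊆ I ∧ ZS (p * q) a b (V.biUnion id) := by
  have hd : (V : Set (Finset ι)).PairwiseDisjoint id := hF.1.subset (by exact_mod_cast hV)
  have key : ∀ c : ι → ℤ, (∀ J ∈ V, (p : ℤ) ∣ ∑ i ∈ J, c i) →
      (q : ℤ) ∣ ∑ J ∈ V, (∑ i ∈ J, c i) / (p : ℤ) →
      ((p * q : ℕ) : ℤ) ∣ ∑ i ∈ V.biUnion id, c i := by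
    intro c hc hq
    rw [Finset.sum_biUnion hd]
    have : ∑ J ∈ V, ∑ i ∈ id J, c i = p * ∑ J ∈ V, (∑ i ∈ J, c i) / (p : ℤ) := by
      rw [Finset.mul_sum]
      exact Finset.sum_congr rfl fun J hJ => (Int.mul_ediv_cancel' (hc J hJ)).symm
    rw [this]
    push_cast
    exact mul_dvd_mul_left _ hq
  refine ⟨?_, ?_, ?_, ?_⟩
  · intro x hx
    obtain ⟨K, hK, hx⟩ := Finset.mem_biUnion.1 hx
    exact (hF.2 K (hV hK)).1 hx
  · obtain ⟨K, hK⟩ := hz.1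
    obtain ⟨x, hx⟩ := (hF.2 K (hV hK)).2.1
    exact ⟨x, Finset.mem_biUnion.2 ⟨K, hK, hx⟩⟩
  · exact key a (fun J hJ => (hF.2 J (hV hJ)).2.2.1) hz.2.1
  · exact key b (fun J hJ => (hF.2 J (hV hJ)).2.2.2) hz.2.2

theorem pe_mul.{u} {p q : ℕ} (hp : PE.{u} p) (hq : PE.{u} q) (hq0 : 1 ≤ q) :
    PE.{u} (p * q) := by
  classical
  intro ι a b I h
  obtain ⟨r, rfl⟩ : ∃ r, q = r + 1 := ⟨q - 1, by omega⟩
  obtain ⟨F, hF, hk, hs⟩ := extract hp a b (3 * r + 1) I (by ring_nf at h ⊢; omega)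
  obtain ⟨V, hV, hz, hc⟩ := hq _ (fun J => (∑ i ∈ J, a i) / (p : ℤ))
    (fun J => (∑ i ∈ J, b i) / (p : ℤ)) F (by omega)
  obtain ⟨h1, h2⟩ := combine hF hV hz
  refine ⟨_, h1, h2, ?_⟩
  calc _ ≤ V.card * p := Finset.card_biUnion_le_card_mul _ _ _ fun J hJ => hs J (hV hJ)
    _ ≤ (r + 1) * p := Nat.mul_le_mul_right _ hc
    _ = _ := by ring

theorem pd_mul.{u} {p q : ℕ} (hp : PE.{u} p) (hpd : PD.{u} p) (hq : PD.{u} q) (hq0 : 1 ≤ q)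
    (hp0 : 1 ≤ p) : PD.{u} (p * q) := by
  classical
  intro ι a b I h
  obtain ⟨r, rfl⟩ : ∃ r, q = r + 1 := ⟨q - 1, by omega⟩
  have e1 : 2 * (p * (r + 1)) = 2 * r * p + 2 * p := by ring
  obtain ⟨F, hF, hk, hs⟩ := extract hp a b (2 * r) I (by omega)
  have hu : (F.biUnion id).card ≤ F.card * p := Finset.card_biUnion_le_card_mul _ _ _ hs
  have hsub : F.biUnion id ⊆ I := by
    intro x hx
    obtain ⟨K, hK, hx⟩ := Finset.mem_biUnion.1 hx
    exact (hF.2 K hK).1 hx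
  have hcs := Finset.card_sdiff_add_card_eq_card hsub
  rw [hk] at hu
  obtain ⟨J, hJ, hJz⟩ := hpd ι a b (I \ F.biUnion id) (by omega)
  obtain ⟨hF', hc'⟩ := extract' hF hJ hJz
  obtain ⟨V, hV, hz⟩ := hq _ (fun J => (∑ i ∈ J, a i) / (p : ℤ))
    (fun J => (∑ i ∈ J, b i) / (p : ℤ)) (insert J F) (by omega)
  obtain ⟨h1, h2⟩ := combine hF' hV hz
  exact ⟨_, h1, h2⟩

theorem pd_pe.{u} (n : ℕ) (hn : 1 ≤ n) : PD.{u} n ∧ PE.{u} n := by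
  induction n using Nat.prime_composite_induction with
  | zero => omega
  | one =>
    have : PE.{u} 1 := by
      intro ι a b I h
      obtain ⟨x, hx⟩ := Finset.card_pos.1 (show 0 < I.card by omega)
      exact ⟨{x}, by simpa using hx, ⟨by simp, by simp, by simp⟩, by simp⟩
    refine ⟨?_, this⟩
    intro ι a b I h
    obtain ⟨J, h1, h2, _⟩ := this ι a b I (by omega)
    exact ⟨J, h1, h2⟩
  | prime p hp => exact ⟨pd_prime p hp, pe_prime p hp⟩
  | composite p hp ihp q hq ihq =>
    have h1 := ihp (by omega)
    have h2 := ihq (by omega)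
    exact ⟨pd_mul h1.2 h1.1 h2.1 (by omega) (by omega), pe_mul h1.2 h2.2 (by omega)⟩

theorem part1 {ι : Type*} [Fintype ι] {m n : ℕ} (hm : 2 ≤ m) {a b : ι → ℤ}
    (hmin : ∀ J, ZS (m * n) a b J → J = Finset.univ)
    (F : Finset (Finset ι)) (hF : Fam n a b Finset.univ F) (hc : F.card = 2 * m) : False := by
  classical
  obtain ⟨W, hW⟩ := Finset.card_pos.1 (show 0 < F.card by omega)
  have hce := Finset.card_erase_of_mem hW
  obtain ⟨V, hV, hz⟩ := (pd_pe m (by omega)).1 _ (fun J => (∑ i ∈ J, a i) / (n : ℤ))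
    (fun J => (∑ i ∈ J, b i) / (n : ℤ)) (F.erase W) (by omega)
  obtain ⟨_, h2⟩ := combine hF (hV.trans (Finset.erase_subset _ _)) hz
  rw [mul_comm] at h2
  have := hmin _ h2
  obtain ⟨x, hx⟩ := (hF.2 W hW).2.1
  have hxU : x ∈ V.biUnion id := by rw [this]; simp
  obtain ⟨K, hK, hxK⟩ := Finset.mem_biUnion.1 hxU
  have hKF := Finset.mem_erase.1 (hV hK)
  have hd : Disjoint K W := hF.1 hKF.2 hW hKF.1
  exact Finset.disjoint_left.1 hd hxK hx

theorem part2 {ι : Type*} [Fintype ι] {m n : ℕ} (hm : 2 ≤ m) (hn : 2 ≤ n) {a b : ι → ℤ}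
    (hcard : Fintype.card ι = 2 * (m * n) - 1)
    (htot : ZS (m * n) a b Finset.univ)
    (hmin : ∀ J, ZS (m * n) a b J → J = Finset.univ)
    (T : Finset ι) (hT : ZS n a b T) (hTc : T.card < n) : False := by
  classical
  obtain ⟨hD, hE⟩ := pd_pe n (by omega)
  obtain ⟨r, rfl⟩ : ∃ r, m = r + 2 := ⟨m - 2, by omega⟩
  have htot' : ZS n a b Finset.univ :=
    ⟨htot.1, (by push_cast; exact dvd_mul_left _ _ : (n : ℤ) ∣ (((r + 2) * n : ℕ) : ℤ)).trans htot.2.1,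
      (by push_cast; exact dvd_mul_left _ _ : (n : ℤ) ∣ (((r + 2) * n : ℕ) : ℤ)).trans htot.2.2⟩
  have e1 : 2 * ((r + 2) * n) = 2 * (r * n) + 4 * n := by ring
  have e2 : (2 * r + 1) * n = 2 * (r * n) + n := by ring
  have hTs := Finset.card_sdiff_add_card_eq_card (Finset.subset_univ T)
  rw [Finset.card_univ] at hTs
  obtain ⟨F, hF, hk, hs⟩ := extract hE a b (2 * r + 1) (Finset.univ \ T) (by omega)
  have hu : (F.biUnion id).card ≤ F.card * n := Finset.card_biUnion_le_card_mul _ _ _ hs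
  obtain ⟨hF1, hc1⟩ := fam_insert (Finset.subset_univ T) hT hF
  set F1 := insert T F with hF1def
  set U := F1.biUnion id with hU
  have hUc : U.card ≤ T.card + (F.biUnion id).card := by
    rw [hU, hF1def, Finset.biUnion_insert]
    exact Finset.card_union_le _ _
  have hUs := Finset.card_sdiff_add_card_eq_card (Finset.subset_univ U)
  rw [Finset.card_univ] at hUs
  rw [hk] at hu
  have hR : 2 * n ≤ (Finset.univ \ U).card := by omega
  -- the total of `U` is zero-sum
  have hUz : ZS n a b U := by
    refine ⟨?_, ?_, ?_⟩
    · obtain ⟨x, hx⟩ := hT.1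
      exact ⟨x, Finset.mem_biUnion.2 ⟨T, by simp [hF1def], hx⟩⟩
    · rw [hU, Finset.sum_biUnion hF1.1]
      exact Finset.dvd_sum fun J hJ => (hF1.2 J hJ).2.2.1
    · rw [hU, Finset.sum_biUnion hF1.1]
      exact Finset.dvd_sum fun J hJ => (hF1.2 J hJ).2.2.2
  have hRz : ZS n a b (Finset.univ \ U) := by
    apply zs_sdiff htot' hUz (Finset.subset_univ U)
    intro h
    rw [h] at hR
    simp at hR
    omega
  obtain ⟨j, hj⟩ := hRz.1
  have hce := Finset.card_erase_of_mem hj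
  obtain ⟨K, hK, hKz⟩ := hD ι a b ((Finset.univ \ U).erase j) (by omega)
  have hKR : K ⊆ Finset.univ \ U := hK.trans (Finset.erase_subset _ _)
  have hKne : K ≠ Finset.univ \ U := by
    intro h
    rw [h] at hK
    exact Finset.notMem_erase j _ (hK hj)
  have hLz := zs_sdiff hRz hKz hKR hKne
  obtain ⟨hF2, hc2⟩ := extract' hF1 hKR hKz
  have hL : (Finset.univ \ U) \ K ⊆ Finset.univ \ (insert K F1).biUnion id := by
    rw [Finset.biUnion_insert]
    intro x hx
    simp only [Finset.mem_sdiff, Finset.mem_univ, true_and, Finset.mem_union, id] at hx ⊢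
    tauto
  obtain ⟨hF3, hc3⟩ := extract' hF2 hL hLz
  exact part1 hm hmin _ hF3 (by omega)

theorem lift_sub {ι β : Type*} [DecidableEq ι] (h : ι → β) (T : Multiset β) :
    ∀ J : Finset ι, T ≤ J.val.map h → ∃ K ⊆ J, T = K.val.map h := by
  induction T using Multiset.induction with
  | empty => intro J _; exact ⟨∅, by simp, by simp⟩
  | cons x T ih =>
    intro J hT
    have hx : x ∈ J.val.map h := Multiset.mem_of_le hT (Multiset.mem_cons_self x T)
    obtain ⟨j, hj, rfl⟩ := Multiset.mem_map.1 hx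
    have hj' : j ∈ J := hj
    have hins : (insert j (J.erase j)).val.map h = h j ::ₘ (J.erase j).val.map h := by
      rw [Finset.insert_val_of_notMem (Finset.notMem_erase j J), Multiset.map_cons]
    rw [Finset.insert_erase hj'] at hins
    rw [hins, Multiset.cons_le_cons_iff] at hT
    obtain ⟨K, hK, rfl⟩ := ih _ hT
    refine ⟨insert j K, ?_, ?_⟩
    · exact Finset.insert_subset hj' (hK.trans (Finset.erase_subset _ _))
    · rw [Finset.insert_val_of_notMem (fun hjK => Finset.notMem_erase j J (hK hjK)),
        Multiset.map_cons]

theorem lift_fam {ι β κ : Type*} [DecidableEq ι] [DecidableEq κ] [AddCommMonoid β] (h : ι → β)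
    {n : ℕ} {a b : ι → ℤ}
    (hz : ∀ K : Finset ι, (K.val.map h).sum = 0 → K.Nonempty → ZS n a b K)
    (W : κ → Multiset β) (hW : ∀ i, W i ≠ 0 ∧ (W i).sum = 0) (A : Finset κ) :
    ∀ I : Finset ι, (∑ i ∈ A, W i) ≤ I.val.map h → ∃ F, Fam n a b I F ∧ F.card = A.card := by
  induction A using Finset.induction with
  | empty => intro I _; exact ⟨∅, by simp [Fam], by simp⟩
  | insert k A hk ih =>
    intro I hI
    rw [Finset.sum_insert hk] at hI
    obtain ⟨K, hK, hWK⟩ := lift_sub h (W k) I (le_trans (Multiset.le_add_right _ _) hI)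
    have hsplit : I.val.map h = K.val.map h + (I \ K).val.map h := by
      rw [← Multiset.map_add]
      congr 1
      rw [Finset.sdiff_val, add_tsub_cancel_of_le (Finset.val_le_iff.2 hK)]
    rw [hsplit, hWK, add_le_add_iff_left] at hI
    obtain ⟨F, hF, hc⟩ := ih _ hI
    have hKn : K.Nonempty := by
      rw [Finset.nonempty_iff_ne_empty]
      rintro rfl
      exact (hW k).1 (by simpa using hWK)
    obtain ⟨h1, h2⟩ := fam_insert hK (hz K (hWK ▸ (hW k).2) hKn) hF
    exact ⟨_, h1, by rw [h2, hc, Finset.card_insert_of_notMem hk]⟩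

theorem stmt_16 (m n : ℕ) (hm : 2 ≤ m) (hn : 2 ≤ n)
    (S : Multiset (ZMod (m * n) × ZMod (m * n)))
    (hmin : IsMinZeroSum S) (hlen : Multiset.card S = 2 * (m * n) - 1) :
    (¬ ∃ W : Fin (2 * m) → Multiset (ZMod (m * n) × ZMod (m * n)),
        (∑ i, W i) = S.map (fun g => m • g) ∧ ∀ i, W i ≠ 0 ∧ (W i).sum = 0) ∧
    (∀ T ≤ S.map (fun g => m • g), T.sum = 0 → 1 ≤ Multiset.card T →
        Multiset.card T ≤ n → Multiset.card T = n) ∧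
    (0 : ZMod (m * n) × ZMod (m * n)) ∉ S.map (fun g => m • g) := by
  classical
  have hmn : m * n ≠ 0 := by positivity
  haveI : NeZero (m * n) := ⟨hmn⟩
  obtain ⟨N, g, hg⟩ : ∃ (N : ℕ) (g : Fin N → ZMod (m * n) × ZMod (m * n)),
      S = (Finset.univ : Finset (Fin N)).val.map g := by
    refine ⟨S.toList.length, S.toList.get, ?_⟩
    conv_lhs => rw [← Multiset.coe_toList S]
    rw [Fin.univ_val_map, List.ofFn_get]
  have hcard : Fintype.card (Fin N) = 2 * (m * n) - 1 := by
    rw [← hlen, hg]; simp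
  let a : Fin N → ℤ := fun i => ((g i).1.val : ℤ)
  let b : Fin N → ℤ := fun i => ((g i).2.val : ℤ)
  have hsum : ∀ J : Finset (Fin N), (J.val.map g).sum
      = (((∑ i ∈ J, a i : ℤ) : ZMod (m * n)), ((∑ i ∈ J, b i : ℤ) : ZMod (m * n))) := by
    intro J
    change ∑ i ∈ J, g i = _
    ext <;> simp [a, b, Prod.fst_sum, Prod.snd_sum]
  have hzero : ∀ J : Finset (Fin N), J.Nonempty → (J.val.map g).sum = 0 → ZS (m * n) a b J := by
    intro J hJ h
    rw [hsum, Prod.mk_eq_zero, ZMod.intCast_zmod_eq_zero_iff_dvd,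
      ZMod.intCast_zmod_eq_zero_iff_dvd] at h
    exact ⟨hJ, h⟩
  have hzero' : ∀ J : Finset (Fin N), ZS (m * n) a b J → (J.val.map g).sum = 0 := by
    intro J hJ
    rw [hsum, Prod.mk_eq_zero, ZMod.intCast_zmod_eq_zero_iff_dvd,
      ZMod.intCast_zmod_eq_zero_iff_dvd]
    exact hJ.2
  have hm0 : (m : ℤ) ≠ 0 := by exact_mod_cast (by omega : m ≠ 0)
  let h : Fin N → ZMod (m * n) × ZMod (m * n) := fun i => m • g i
  have hz : ∀ K : Finset (Fin N), (K.val.map h).sum = 0 → K.Nonempty → ZS n a b K := by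
    intro K hK hne
    have e : (K.val.map h).sum = m • (K.val.map g).sum := by
      change ∑ i ∈ K, m • g i = m • ∑ i ∈ K, g i
      rw [Finset.smul_sum]
    have key : ∀ c : ℤ, m • (c : ZMod (m * n)) = 0 → (n : ℤ) ∣ c := by
      intro c hc
      have : ((m * c : ℤ) : ZMod (m * n)) = 0 := by
        rw [← hc]; simp
      rw [ZMod.intCast_zmod_eq_zero_iff_dvd] at this
      push_cast at this
      exact Int.dvd_of_mul_dvd_mul_left hm0 this
    rw [e, hsum, Prod.smul_mk, Prod.mk_eq_zero] at hK
    exact ⟨hne, key _ hK.1, key _ hK.2⟩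
  have hmap : S.map (fun g => m • g) = (Finset.univ : Finset (Fin N)).val.map h := by
    rw [hg, Multiset.map_map]; rfl
  have hne : (Finset.univ : Finset (Fin N)).Nonempty := by
    rw [Finset.nonempty_iff_ne_empty]
    intro h0
    apply hmin.1
    rw [hg, h0]; simp
  have htot : ZS (m * n) a b Finset.univ := hzero _ hne (by rw [← hg]; exact hmin.2.1)
  have hmin' : ∀ J, ZS (m * n) a b J → J = Finset.univ := by
    intro J hJ
    by_contra hJu
    refine hmin.2.2 (J.val.map g) ?_ ?_ ?_ (hzero' J hJ)
    · rw [hg]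
      exact Multiset.map_le_map (Finset.val_le_iff.2 (Finset.subset_univ J))
    · intro h0
      rw [Multiset.map_eq_zero, Finset.val_eq_zero] at h0
      exact hJ.1.ne_empty h0
    · intro h0
      rw [hg] at h0
      have := congrArg Multiset.card h0
      simp only [Multiset.card_map, Finset.card_val] at this
      exact hJu (Finset.eq_univ_of_card J this)
  have P2 : ∀ T ≤ S.map (fun g => m • g), T.sum = 0 → 1 ≤ Multiset.card T →
        Multiset.card T ≤ n → Multiset.card T = n := by
    intro T hT hT0 h1 hTn
    by_contra hlt
    rw [hmap] at hT
    obtain ⟨K, _, rfl⟩ := lift_sub h T _ hT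
    simp only [Multiset.card_map, Finset.card_val] at h1 hTn hlt
    exact part2 hm hn hcard htot hmin' K (hz K hT0 (Finset.card_pos.1 h1)) (by omega)
  refine ⟨?_, P2, ?_⟩
  · rintro ⟨W, hWs, hW⟩
    rw [hmap] at hWs
    obtain ⟨F, hF, hc⟩ := lift_fam h hz W hW Finset.univ Finset.univ hWs.le
    exact part1 hm hmin' F hF (by simpa using hc)
  · intro h0
    have := P2 {0} (Multiset.singleton_le.2 h0) (by simp) (by simp) (by simp; omega)
    simp at this
    omega
end
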